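/- Suppose w: S² → ℝ is a smooth solution of the mean field equation Δ_{g₀} w = 6 - 6e^w on the round sphere (S², g₀) that satisfies the even symmetry w(x) = w(-x) for all x. Then w ≡ 0. -/

import Mathlib

open Real

/-- The Laplace–Beltrami operator on the unit sphere `S² ⊂ ℝ³`, computed via
the degree-zero homogeneous extension: for `x` on the unit sphere,
`Δ_{S²} w (x) = Δ_{ℝ³} W (x)` where `W(y) = w(y/‖y‖)`. -/
noncomputable def sphereLaplacian (w : EuclideanSpace ℝ (Fin 3) → ℝ)
    (x : EuclideanSpace ℝ (Fin 3)) : ℝ :=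
  ∑ i : Fin 3, iteratedFDeriv ℝ 2 (fun y => w (‖y‖⁻¹ • y)) x
    ![EuclideanSpace.single i 1, EuclideanSpace.single i 1]

namespace MeanField

open Filter Topology ContDiff InnerProductSpace Laplacian

/-- The Euclidean space `ℝ³`. -/
abbrev E3 : Type := EuclideanSpace ℝ (Fin 3)

/-- The second-order Taylor data of a function of one variable at `0`: the function is
differentiable near `0`, with value `a`, derivative `b` and second derivative `c` at `0`. -/
def Jet (g : ℝ → ℝ) (a b c : ℝ) : Prop :=
  g 0 = a ∧ ∃ g' : ℝ → ℝ, (∀ᶠ t in 𝓝 0, HasDerivAt g (g' t) t) ∧ g' 0 = b ∧ HasDerivAt g' c 0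

namespace Jet

variable {f g : ℝ → ℝ} {a b c a₁ b₁ c₁ : ℝ}

theorem value (h : Jet f a b c) : f 0 = a := h.1

theorem hasDerivAt (h : Jet f a b c) : HasDerivAt f b 0 := by
  obtain ⟨-, f', hf, rfl, -⟩ := h
  exact hf.self_of_nhds

theorem tendsto (h : Jet f a b c) : Tendsto f (𝓝 0) (𝓝 a) := by
  have := h.hasDerivAt.continuousAt.tendsto
  rwa [h.value] at this

protected theorem const (k : ℝ) : Jet (fun _ => k) k 0 0 :=
  ⟨rfl, fun _ => 0, Eventually.of_forall fun t => hasDerivAt_const t k, rfl,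
    hasDerivAt_const 0 0⟩

protected theorem add (hf : Jet f a b c) (hg : Jet g a₁ b₁ c₁) :
    Jet (fun t => f t + g t) (a + a₁) (b + b₁) (c + c₁) := by
  obtain ⟨rfl, f', hf, rfl, hf'⟩ := hf
  obtain ⟨rfl, g', hg, rfl, hg'⟩ := hg
  refine ⟨rfl, fun t => f' t + g' t, ?_, rfl, hf'.add hg'⟩
  filter_upwards [hf, hg] with t h₁ h₂ using h₁.add h₂

protected theorem mul (hf : Jet f a b c) (hg : Jet g a₁ b₁ c₁) :
    Jet (fun t => f t * g t) (a * a₁) (b * a₁ + a * b₁) (c * a₁ + 2 * b * b₁ + a * c₁) := by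
  have h₀ := hf.hasDerivAt
  have h₁ := hg.hasDerivAt
  obtain ⟨rfl, f', hf, rfl, hf'⟩ := hf
  obtain ⟨rfl, g', hg, rfl, hg'⟩ := hg
  refine ⟨rfl, fun t => f' t * g t + f t * g' t, ?_, rfl, ?_⟩
  · filter_upwards [hf, hg] with t h₁ h₂ using h₁.mul h₂
  · exact ((hf'.mul h₁).add (h₀.mul hg')).congr_deriv (by ring)

protected theorem comp {φ φ' : ℝ → ℝ} {d : ℝ} (hf : Jet f a b c)
    (hφ : ∀ᶠ s in 𝓝 a, HasDerivAt φ (φ' s) s) (hφ' : HasDerivAt φ' d a) :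
    Jet (fun t => φ (f t)) (φ a) (φ' a * b) (d * b ^ 2 + φ' a * c) := by
  have h₀ := hf.hasDerivAt
  have ht := hf.tendsto
  obtain ⟨rfl, f', hf, rfl, hf'⟩ := hf
  refine ⟨rfl, fun t => φ' (f t) * f' t, ?_, rfl, ?_⟩
  · filter_upwards [hf, ht.eventually hφ] with t h₁ h₂ using h₂.comp t h₁
  · exact ((hφ'.comp 0 h₀).mul hf').congr_deriv (by simp only [Function.comp_apply]; ring)

protected theorem const_mul (k : ℝ) (hf : Jet f a b c) :
    Jet (fun t => k * f t) (k * a) (k * b) (k * c) := by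
  convert (Jet.const k).mul hf using 1 <;> ring

protected theorem neg (hf : Jet f a b c) : Jet (fun t => -f t) (-a) (-b) (-c) := by
  convert hf.const_mul (-1) using 1
  · ext t; ring
  all_goals ring

protected theorem sub (hf : Jet f a b c) (hg : Jet g a₁ b₁ c₁) :
    Jet (fun t => f t - g t) (a - a₁) (b - b₁) (c - c₁) := by
  simpa only [sub_eq_add_neg] using hf.add hg.neg

protected theorem sq (hf : Jet f a b c) :
    Jet (fun t => f t ^ 2) (a ^ 2) (2 * a * b) (2 * b ^ 2 + 2 * a * c) := by
  convert hf.mul hf using 1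
  · ext t; ring
  all_goals ring

protected theorem exp (hf : Jet f a b c) :
    Jet (fun t => Real.exp (f t)) (Real.exp a) (Real.exp a * b)
      (Real.exp a * b ^ 2 + Real.exp a * c) :=
  hf.comp (Eventually.of_forall Real.hasDerivAt_exp) (Real.hasDerivAt_exp a)

protected theorem cosh (hf : Jet f a b c) :
    Jet (fun t => Real.cosh (f t)) (Real.cosh a) (Real.sinh a * b)
      (Real.cosh a * b ^ 2 + Real.sinh a * c) :=
  hf.comp (Eventually.of_forall Real.hasDerivAt_cosh) (Real.hasDerivAt_sinh a)

protected theorem inv (hf : Jet f a b c) (ha : a ≠ 0) :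
    Jet (fun t => (f t)⁻¹) a⁻¹ (-b / a ^ 2) (2 * b ^ 2 / a ^ 3 - c / a ^ 2) := by
  have h : HasDerivAt (fun s : ℝ => -(s ^ 2)⁻¹) (2 / a ^ 3) a := by
    refine ((hasDerivAt_pow 2 a).inv (pow_ne_zero 2 ha)).neg.congr_deriv ?_
    field_simp
    norm_num
    ring
  convert hf.comp ((eventually_ne_nhds ha).mono fun s hs => hasDerivAt_inv hs) h using 1 <;>
    field_simp <;> ring

protected theorem log (hf : Jet f a b c) (ha : a ≠ 0) :
    Jet (fun t => Real.log (f t)) (Real.log a) (b / a) (c / a - (b / a) ^ 2) := by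
  convert hf.comp ((eventually_ne_nhds ha).mono fun s hs => Real.hasDerivAt_log hs)
    (hasDerivAt_inv ha) using 1 <;> field_simp
  ring

/-- At a local maximum the second derivative is nonpositive. -/
theorem nonpos_of_isLocalMax (hf : Jet f a b c) (h : IsLocalMax f 0) : c ≤ 0 := by
  by_contra! hc
  have hb : b = 0 := h.hasDerivAt_eq_zero hf.hasDerivAt
  have hcont := hf.hasDerivAt.continuousAt
  obtain ⟨rfl, f', hf, hb', hf'⟩ := hf
  have hd : deriv f =ᶠ[𝓝 0] f' := by filter_upwards [hf] with t ht using ht.deriv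
  have hmin : IsLocalMin f 0 := isLocalMin_of_deriv_deriv_pos
    (by rw [hd.deriv_eq, hf'.deriv]; exact hc) (by rw [hd.self_of_nhds, hb', hb]) hcont
  have hconst : f =ᶠ[𝓝 0] fun _ => f 0 := by
    filter_upwards [h, hmin] with t h₁ h₂ using le_antisymm h₁ h₂
  have h0 : f' =ᶠ[𝓝 0] fun _ => 0 := by
    filter_upwards [hconst.eventually_nhds, hf] with t h₁ h₂
    exact h₂.unique ((hasDerivAt_const t (f 0)).congr_of_eventuallyEq h₁)
  have := hf'.unique ((hasDerivAt_const (0 : ℝ) (0 : ℝ)).congr_of_eventuallyEq h0)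
  exact hc.ne' this

end Jet

/-- The derivative of `f` in the direction `v`. -/
noncomputable def dirDeriv (v : E3) (f : E3 → ℝ) (y : E3) : ℝ := fderiv ℝ f y v

/-- Smoothness away from the origin. -/
def SmoothOff (f : E3 → ℝ) : Prop := ∀ y, y ≠ 0 → ContDiffAt ℝ ∞ f y

namespace SmoothOff

variable {f g : E3 → ℝ}

theorem dirDeriv (hf : SmoothOff f) (v : E3) : SmoothOff (dirDeriv v f) := fun y hy =>
  ((hf y hy).fderiv_right (m := ∞) (by norm_cast)).clm_apply contDiffAt_const

theorem differentiableAt (hf : SmoothOff f) {y : E3} (hy : y ≠ 0) : DifferentiableAt ℝ f y :=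
  (hf y hy).differentiableAt (by norm_num)

theorem continuousAt (hf : SmoothOff f) {y : E3} (hy : y ≠ 0) : ContinuousAt f y :=
  (hf.differentiableAt hy).continuousAt

theorem continuousOn (hf : SmoothOff f) {s : Set E3} (hs : ∀ y ∈ s, y ≠ 0) : ContinuousOn f s :=
  fun y hy => (hf.continuousAt (hs y hy)).continuousWithinAt

theorem hasFDerivAt (hf : SmoothOff f) {y : E3} (hy : y ≠ 0) :
    HasFDerivAt f (fderiv ℝ f y) y := (hf.differentiableAt hy).hasFDerivAt

/-- The derivative of `f` along a curve. -/
theorem hasDerivAt_comp (hf : SmoothOff f) {γ : ℝ → E3} {γ' : E3} {t : ℝ} (hγ : HasDerivAt γ γ' t)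
    (h0 : γ t ≠ 0) : HasDerivAt (fun s => f (γ s)) (MeanField.dirDeriv γ' f (γ t)) t :=
  (hf.hasFDerivAt h0).comp_hasDerivAt t hγ

theorem jet (hf : SmoothOff f) {x : E3} (hx : x ≠ 0) (v : E3) :
    Jet (fun t => f (x + t • v)) (f x) (MeanField.dirDeriv v f x)
      (MeanField.dirDeriv v (MeanField.dirDeriv v f) x) := by
  have hline : ∀ t : ℝ, HasDerivAt (fun s : ℝ => x + s • v) v t := fun t => by
    simpa using ((hasDerivAt_id t).smul_const v).const_add x
  have hne : ∀ᶠ t : ℝ in 𝓝 0, x + t • v ≠ 0 := by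
    have : ContinuousAt (fun s : ℝ => x + s • v) 0 := (hline 0).continuousAt
    exact this.eventually_ne (by simpa using hx)
  refine ⟨by simp, fun t => MeanField.dirDeriv v f (x + t • v), ?_, by simp, ?_⟩
  · filter_upwards [hne] with t ht using hf.hasDerivAt_comp (hline t) ht
  · simpa using (hf.dirDeriv v).hasDerivAt_comp (hline 0) (by simpa using hx)

/-- Symmetry of second derivatives. -/
theorem dirDeriv_comm (hf : SmoothOff f) {y : E3} (hy : y ≠ 0) (v w : E3) :
    MeanField.dirDeriv v (MeanField.dirDeriv w f) y =
      MeanField.dirDeriv w (MeanField.dirDeriv v f) y := by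
  have hd : DifferentiableAt ℝ (fderiv ℝ f) y :=
    ((hf y hy).fderiv_right (m := 1) (by norm_cast)).differentiableAt (by norm_num)
  have key : ∀ a b : E3, MeanField.dirDeriv a (MeanField.dirDeriv b f) y
      = fderiv ℝ (fderiv ℝ f) y a b := fun a b => by
    have : HasFDerivAt (MeanField.dirDeriv b f) _ y :=
      hd.hasFDerivAt.clm_apply (hasFDerivAt_const b y)
    rw [MeanField.dirDeriv, this.fderiv]
    simp
  rw [key, key]
  exact ((hf y hy).isSymmSndFDerivAt (by simp; norm_cast)).eq v w

end SmoothOff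

theorem laplacian_eq_sum {f : E3 → ℝ} (hf : SmoothOff f) {y : E3} (hy : y ≠ 0)
    (b : OrthonormalBasis (Fin 3) ℝ E3) :
    Δ f y = ∑ i, dirDeriv (b i) (dirDeriv (b i) f) y := by
  have hd : DifferentiableAt ℝ (fderiv ℝ f) y :=
    ((hf y hy).fderiv_right (m := 1) (by norm_cast)).differentiableAt (by norm_num)
  rw [laplacian_eq_iteratedFDeriv_orthonormalBasis f b]
  refine Finset.sum_congr rfl fun i _ => ?_
  rw [iteratedFDeriv_two_apply]
  have : HasFDerivAt (dirDeriv (b i) f) _ y := hd.hasFDerivAt.clm_apply (hasFDerivAt_const (b i) y)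
  rw [dirDeriv, this.fderiv]
  simp

/-- The squared length of the gradient does not depend on the orthonormal basis. -/
theorem sum_dirDeriv_sq (f : E3 → ℝ) (y : E3) (b : OrthonormalBasis (Fin 3) ℝ E3) :
    ∑ i, dirDeriv (b i) f y ^ 2 = ‖fderiv ℝ f y‖ ^ 2 := by
  have h := b.sum_sq_norm_inner_right ((toDual ℝ E3).symm (fderiv ℝ f y))
  rw [LinearIsometryEquiv.norm_map] at h
  rw [← h]
  refine Finset.sum_congr rfl fun i _ => ?_
  rw [real_inner_comm, toDual_symm_apply, Real.norm_eq_abs, sq_abs, dirDeriv]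

end MeanField

namespace MeanField

open Filter Topology ContDiff InnerProductSpace Laplacian

theorem dirDeriv_congr {f g : E3 → ℝ} {y : E3} (h : f =ᶠ[𝓝 y] g) (v : E3) :
    dirDeriv v f y = dirDeriv v g y := by
  rw [dirDeriv, dirDeriv, h.fderiv_eq]

theorem hasDerivAt_line (x v : E3) (t : ℝ) : HasDerivAt (fun s : ℝ => x + s • v) v t := by
  simpa using ((hasDerivAt_id t).smul_const v).const_add x

/-- Homogeneity of degree zero. -/
def HomogZero (f : E3 → ℝ) : Prop := ∀ c : ℝ, 0 < c → ∀ y, f (c • y) = f y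

theorem HomogZero.dirDeriv_smul {f : E3 → ℝ} (hf : HomogZero f) {c : ℝ} (hc : 0 < c)
    (v y : E3) : dirDeriv v f (c • y) = c⁻¹ * dirDeriv v f y := by
  have h : (fun z => f (c • z)) = f := funext fun z => hf c hc z
  have h' := fderiv_comp_smul (𝕜 := ℝ) (f := f) (x := y) c
  rw [h] at h'
  rw [dirDeriv, dirDeriv, h']
  simp [hc.ne']

theorem HomogZero.dirDeriv_self {f : E3 → ℝ} (hf : HomogZero f) (hs : SmoothOff f) {y : E3}
    (hy : y ≠ 0) : dirDeriv y f y = 0 := by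
  have h1 : HasDerivAt (fun t : ℝ => f (t • y)) (dirDeriv y f y) 1 := by
    have h2 : HasDerivAt (fun t : ℝ => t • y) y 1 := by
      simpa using (hasDerivAt_id (1 : ℝ)).smul_const y
    simpa using hs.hasDerivAt_comp h2 (by simpa using hy)
  refine h1.unique ((hasDerivAt_const (1 : ℝ) (f y)).congr_of_eventuallyEq ?_)
  filter_upwards [lt_mem_nhds (zero_lt_one' ℝ)] with t ht using hf t ht y

theorem HomogZero.dirDeriv_dirDeriv_self {f : E3 → ℝ} (hf : HomogZero f) (hs : SmoothOff f)
    {y : E3} (hy : y ≠ 0) (v : E3) : dirDeriv y (dirDeriv v f) y = -dirDeriv v f y := by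
  have h1 : HasDerivAt (fun t : ℝ => dirDeriv v f (t • y)) (dirDeriv y (dirDeriv v f) y) 1 := by
    have h2 : HasDerivAt (fun t : ℝ => t • y) y 1 := by
      simpa using (hasDerivAt_id (1 : ℝ)).smul_const y
    simpa using (hs.dirDeriv v).hasDerivAt_comp h2 (by simpa using hy)
  have h3 : HasDerivAt (fun t : ℝ => t⁻¹ * dirDeriv v f y) (-dirDeriv v f y) 1 := by
    simpa using (hasDerivAt_inv (one_ne_zero' ℝ)).mul_const (dirDeriv v f y)
  refine h1.unique (h3.congr_of_eventuallyEq ?_)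
  filter_upwards [lt_mem_nhds (zero_lt_one' ℝ)] with t ht using hf.dirDeriv_smul ht v y

/-- `W` is the degree-zero homogeneous extension of an even solution of the mean field equation
on the unit sphere. -/
structure IsSol (W : E3 → ℝ) : Prop where
  smooth : SmoothOff W
  homog : HomogZero W
  even : ∀ y, W (-y) = W y
  pde : ∀ y, y ≠ 0 → ‖y‖ ^ 2 * Δ W y = 6 - 6 * Real.exp (W y)

theorem SmoothOff.comp_isometry {f : E3 → ℝ} (hf : SmoothOff f) (R : E3 ≃ₗᵢ[ℝ] E3) :
    SmoothOff (fun y => f (R y)) := fun y hy =>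
  (hf (R y) (by simpa using hy)).comp y R.contDiff.contDiffAt

theorem dirDeriv_comp_isometry {f : E3 → ℝ} (hf : SmoothOff f) (R : E3 ≃ₗᵢ[ℝ] E3) (v : E3)
    {y : E3} (hy : y ≠ 0) : dirDeriv v (fun y => f (R y)) y = dirDeriv (R v) f (R y) := by
  have h : HasFDerivAt (fun y => f (R y)) _ y :=
    (hf.hasFDerivAt (y := R y) (by simpa using hy)).comp y
      R.toContinuousLinearEquiv.hasFDerivAt
  rw [dirDeriv, h.fderiv]
  rfl

theorem dirDeriv_dirDeriv_comp_isometry {f : E3 → ℝ} (hf : SmoothOff f) (R : E3 ≃ₗᵢ[ℝ] E3)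
    (v w : E3) {y : E3} (hy : y ≠ 0) :
    dirDeriv v (dirDeriv w (fun y => f (R y))) y = dirDeriv (R v) (dirDeriv (R w) f) (R y) := by
  rw [← dirDeriv_comp_isometry (hf.dirDeriv (R w)) R v hy]
  refine dirDeriv_congr ?_ v
  filter_upwards [eventually_ne_nhds hy] with z hz using dirDeriv_comp_isometry hf R w hz

theorem laplacian_comp_isometry {f : E3 → ℝ} (hf : SmoothOff f) (R : E3 ≃ₗᵢ[ℝ] E3) {y : E3}
    (hy : y ≠ 0) : Δ (fun y => f (R y)) y = Δ f (R y) := by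
  let b := EuclideanSpace.basisFun (Fin 3) ℝ
  rw [laplacian_eq_sum (hf.comp_isometry R) hy b,
    laplacian_eq_sum hf (y := R y) (by simpa using hy) (b.map R)]
  refine Finset.sum_congr rfl fun i _ => ?_
  rw [dirDeriv_dirDeriv_comp_isometry hf R _ _ hy, OrthonormalBasis.map_apply]

theorem IsSol.comp_isometry {W : E3 → ℝ} (hW : IsSol W) (R : E3 ≃ₗᵢ[ℝ] E3) :
    IsSol (fun y => W (R y)) where
  smooth := hW.smooth.comp_isometry R
  homog c hc y := by change W (R (c • y)) = W (R y); rw [map_smul]; exact hW.homog c hc (R y)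
  even y := by rw [map_neg]; exact hW.even (R y)
  pde y hy := by
    rw [laplacian_comp_isometry hW.smooth R hy, ← hW.pde (R y) (by simpa using hy), R.norm_map]

/-- The equations satisfied by the difference `u` and the mean `m` of two solutions. -/
structure IsPair (u m : E3 → ℝ) : Prop where
  smooth_u : SmoothOff u
  smooth_m : SmoothOff m
  homog_u : HomogZero u
  homog_m : HomogZero m
  even_u : ∀ y, u (-y) = u y
  even_m : ∀ y, m (-y) = m y
  pde_u : ∀ y, y ≠ 0 → ‖y‖ ^ 2 * Δ u y = -12 * (Real.exp (m y) * Real.sinh (u y / 2))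
  pde_m : ∀ y, y ≠ 0 → ‖y‖ ^ 2 * Δ m y = 6 - 6 * Real.exp (m y) * Real.cosh (u y / 2)

theorem IsSol.isPair {V W : E3 → ℝ} (hV : IsSol V) (hW : IsSol W) :
    IsPair (fun y => V y - W y) (fun y => (1 / 2 : ℝ) * (V y + W y)) where
  smooth_u y hy := (hV.smooth y hy).sub (hW.smooth y hy)
  smooth_m y hy := contDiffAt_const.mul ((hV.smooth y hy).add (hW.smooth y hy))
  homog_u c hc y := by simp only [hV.homog c hc y, hW.homog c hc y]
  homog_m c hc y := by simp only [hV.homog c hc y, hW.homog c hc y]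
  even_u y := by simp only [hV.even, hW.even]
  even_m y := by simp only [hV.even, hW.even]
  pde_u y hy := by
    have h : Δ (fun y => V y - W y) y = Δ V y - Δ W y :=
      ContDiffAt.laplacian_sub ((hV.smooth y hy).of_le (by norm_cast))
        ((hW.smooth y hy).of_le (by norm_cast))
    rw [h, mul_sub, hV.pde y hy, hW.pde y hy, Real.sinh_eq]
    have h1 : Real.exp (V y) =
        Real.exp (1 / 2 * (V y + W y)) * Real.exp ((V y - W y) / 2) := by
      rw [← Real.exp_add]; ring_nf
    have h2 : Real.exp (W y) =
        Real.exp (1 / 2 * (V y + W y)) * Real.exp (-((V y - W y) / 2)) := by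
      rw [← Real.exp_add]; ring_nf
    rw [h1, h2]
    ring
  pde_m y hy := by
    have h : Δ (fun y => (1 / 2 : ℝ) * (V y + W y)) y = (1 / 2 : ℝ) * (Δ V y + Δ W y) := by
      have h1 : ContDiffAt ℝ 2 V y := (hV.smooth y hy).of_le (by norm_cast)
      have h2 : ContDiffAt ℝ 2 W y := (hW.smooth y hy).of_le (by norm_cast)
      rw [← h1.laplacian_add h2]
      exact laplacian_smul (1 / 2 : ℝ) (h1.add h2)
    rw [h]
    have h1 : Real.exp (V y) =
        Real.exp (1 / 2 * (V y + W y)) * Real.exp ((V y - W y) / 2) := by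
      rw [← Real.exp_add]; ring_nf
    have h2 : Real.exp (W y) =
        Real.exp (1 / 2 * (V y + W y)) * Real.exp (-((V y - W y) / 2)) := by
      rw [← Real.exp_add]; ring_nf
    have h3 := hV.pde y hy
    have h4 := hW.pde y hy
    rw [h1] at h3
    rw [h2] at h4
    rw [Real.cosh_eq]
    linear_combination (1 / 2) * h3 + (1 / 2) * h4

/-- The part of the energy which depends only on `u`. -/
noncomputable def potential (u : E3 → ℝ) (y : E3) : ℝ := 6 * (Real.cosh (1 / 2 * u y) - 1)

/-- The quantity to which the maximum principle is applied. -/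
noncomputable def energy (u m : E3 → ℝ) (y : E3) : ℝ :=
  1 / 4 * (Real.exp (-m y) * (‖y‖ ^ 2 * ‖fderiv ℝ u y‖ ^ 2)) + potential u y

theorem jet_norm_sq (x v : E3) :
    Jet (fun t : ℝ => ‖x + t • v‖ ^ 2) (‖x‖ ^ 2) (2 * ⟪x, v⟫_ℝ) (2 * ‖v‖ ^ 2) := by
  have h : ∀ t : ℝ, HasDerivAt (fun t : ℝ => ‖x + t • v‖ ^ 2) (2 * ⟪x + t • v, v⟫_ℝ) t :=
    fun t => (hasDerivAt_line x v t).norm_sq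
  refine ⟨by simp, fun t => 2 * ⟪x + t • v, v⟫_ℝ, Eventually.of_forall h, by simp, ?_⟩
  refine (((hasDerivAt_line x v 0).inner ℝ (hasDerivAt_const (0 : ℝ) v)).const_mul 2).congr_deriv ?_
  simp

theorem jet_inner (x v p : E3) :
    Jet (fun t : ℝ => ⟪x + t • v, p⟫_ℝ) ⟪x, p⟫_ℝ ⟪v, p⟫_ℝ 0 := by
  refine ⟨by simp, fun _ => ⟪v, p⟫_ℝ, Eventually.of_forall fun t => ?_, rfl, hasDerivAt_const _ _⟩
  refine ((hasDerivAt_line x v t).inner ℝ (hasDerivAt_const t p)).congr_deriv ?_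
  simp

end MeanField

namespace MeanField

open Filter Topology ContDiff InnerProductSpace Laplacian

variable {u m : E3 → ℝ}

theorem orthonormalBasis_inner_eq (b : OrthonormalBasis (Fin 3) ℝ E3) (i j : Fin 3) :
    ⟪b i, b j⟫_ℝ = if i = j then 1 else 0 := orthonormal_iff_ite.mp b.orthonormal i j

/-- The Laplacian of `potential u`. -/
theorem IsPair.jet_potential (h : IsPair u m) {x : E3} (hx : ‖x‖ = 1)
    (b : OrthonormalBasis (Fin 3) ℝ E3) :
    ∃ d₁ d₂ : Fin 3 → ℝ,
      (∀ i, Jet (fun t => potential u (x + t • b i)) (potential u x) (d₁ i) (d₂ i)) ∧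
      (∀ i, d₁ i = 3 * Real.sinh (1 / 2 * u x) * dirDeriv (b i) u x) ∧
      ∑ i, d₂ i = 3 / 2 * Real.cosh (1 / 2 * u x) * ‖fderiv ℝ u x‖ ^ 2 -
        6 * Real.exp (m x) * (Real.cosh (1 / 2 * u x) + 1) * potential u x := by
  have hx0 : x ≠ 0 := fun h0 => by simp [h0] at hx
  have hj := fun i => (((h.smooth_u.jet hx0 (b i)).const_mul (1 / 2)).cosh.sub
    (Jet.const 1)).const_mul 6
  refine ⟨_, _, hj, fun i => by ring, ?_⟩
  have hlap := h.pde_u x hx0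
  rw [laplacian_eq_sum h.smooth_u hx0 b, hx, Fin.sum_univ_three,
    show u x / 2 = 1 / 2 * u x by ring] at hlap
  rw [← sum_dirDeriv_sq u x b]
  simp only [Fin.sum_univ_three, potential]
  linear_combination 3 * Real.sinh (1 / 2 * u x) * hlap
    + 36 * Real.exp (m x) * Real.cosh_sq_sub_sinh_sq (1 / 2 * u x)

/-- The derivative of the equation for `u` in a tangential direction. -/
theorem IsPair.sum_third_deriv (h : IsPair u m) {x : E3} (hx : ‖x‖ = 1)
    (b : OrthonormalBasis (Fin 3) ℝ E3) {v : E3} (hv : ⟪x, v⟫_ℝ = 0) :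
    ∑ i, dirDeriv (b i) (dirDeriv (b i) (dirDeriv v u)) x =
      -12 * Real.exp (m x) * (dirDeriv v m x * Real.sinh (1 / 2 * u x)
        + 1 / 2 * Real.cosh (1 / 2 * u x) * dirDeriv v u x) := by
  have hx0 : x ≠ 0 := fun h0 => by simp [h0] at hx
  have hcomm : ∀ i, dirDeriv (b i) (dirDeriv (b i) (dirDeriv v u)) x =
      dirDeriv v (dirDeriv (b i) (dirDeriv (b i) u)) x := fun i => by
    rw [← (h.smooth_u.dirDeriv (b i)).dirDeriv_comm hx0]
    refine dirDeriv_congr ?_ _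
    filter_upwards [eventually_ne_nhds hx0] with z hz using h.smooth_u.dirDeriv_comm hz _ _
  simp only [hcomm]
  have hsum : HasDerivAt (fun t : ℝ => ∑ i, dirDeriv (b i) (dirDeriv (b i) u) (x + t • v))
      (∑ i, dirDeriv v (dirDeriv (b i) (dirDeriv (b i) u)) x) 0 :=
    HasDerivAt.fun_sum fun i _ =>
      (((h.smooth_u.dirDeriv (b i)).dirDeriv (b i)).jet hx0 v).hasDerivAt
  have hl := (jet_norm_sq x v).hasDerivAt.mul hsum
  have hr := ((((h.smooth_m.jet hx0 v).exp).hasDerivAt.mul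
    ((h.smooth_u.jet hx0 v).const_mul (1 / 2)).hasDerivAt.sinh)).const_mul (-12)
  have hne : ∀ᶠ t : ℝ in 𝓝 0, x + t • v ≠ 0 :=
    (hasDerivAt_line x v 0).continuousAt.eventually_ne (by simpa using hx0)
  have heq := hl.unique (hr.congr_of_eventuallyEq (hne.mono fun t ht => by
    have := h.pde_u _ ht
    rw [laplacian_eq_sum h.smooth_u ht b, div_eq_inv_mul, ← one_div] at this
    exact this))
  simp only [zero_smul, add_zero, hv, hx] at heq
  linear_combination heq

/-- The algebraic identity behind the differential inequality for `energy`. -/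
theorem energy_identity {e E N p q s t h₀ h₁ k sh ch P A P₀ P₁ L : ℝ} (hE : e * E = 1)
    (he : 0 < e) (hc1 : 1 ≤ ch) (hN : N = p ^ 2 + q ^ 2)
    (htr : h₀ + h₁ = -12 * E * sh)
    (hA : A = 1 / 4 * e * N) (hP : P = A + 6 * (ch - 1))
    (hP₀ : P₀ = 1 / 4 * e * (2 * (p * h₀ + q * k) - s * N) + 3 * sh * p)
    (hP₁ : P₁ = 1 / 4 * e * (2 * (p * k + q * h₁) - t * N) + 3 * sh * q)
    (hL : L = 1 / 4 * e * ((s ^ 2 + t ^ 2 - (6 - 6 * E * ch)) * N - 2 * N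
        + (2 * (h₀ ^ 2 + 2 * k ^ 2 + h₁ ^ 2) + 4 * N
          - 24 * E * (p * (s * sh + 1 / 2 * ch * p) + q * (t * sh + 1 / 2 * ch * q)))
        - 4 * (s * (p * h₀ + q * k) + t * (p * k + q * h₁)))
        + (3 / 2 * ch * N - 36 * E * sh ^ 2)) :
    -4 * A * P ≤ P * L - (P₀ ^ 2 + P₁ ^ 2) := by
  obtain ⟨k₁, hk₁⟩ : ∃ k₁, k₁ = (h₀ - h₁) / 2 - (p * s - q * t) / 2 := ⟨_, rfl⟩
  obtain ⟨k₂, hk₂⟩ : ∃ k₂, k₂ = k - (p * t + q * s) / 2 := ⟨_, rfl⟩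
  have e₀ : P₀ = 1 / 2 * e * (k₁ * p + k₂ * q) := by
    rw [hP₀, hk₁, hk₂, hN]
    linear_combination (1 / 4 * e * p) * htr - 3 * sh * p * hE
  have e₁ : P₁ = 1 / 2 * e * (k₂ * p - k₁ * q) := by
    rw [hP₁, hk₁, hk₂, hN]
    linear_combination (1 / 4 * e * q) * htr - 3 * sh * q * hE
  have eL : L = e * (k₁ ^ 2 + k₂ ^ 2) - 4 * A := by
    rw [hL, hk₁, hk₂, hA, hN]
    linear_combination (e / 4 * (h₀ + h₁ - 12 * E * sh) - e / 2 * (p * s + q * t)) * htr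
      + (36 * E * sh ^ 2 - 3 / 2 * ch * (p ^ 2 + q ^ 2)) * hE
  have hid : P * L - (P₀ ^ 2 + P₁ ^ 2) + 4 * A * P = 6 * (ch - 1) * e * (k₁ ^ 2 + k₂ ^ 2) := by
    rw [e₀, e₁, eL, hP, hA, hN]
    ring
  have : 0 ≤ 6 * (ch - 1) * e * (k₁ ^ 2 + k₂ ^ 2) := by
    have : 0 ≤ ch - 1 := by linarith
    positivity
  linarith

/-- The differential inequality `Δ log P ≥ -4 (P - potential) / P` for `P = energy u m`. -/
theorem IsPair.jet_energy (h : IsPair u m) {x : E3} (hx : ‖x‖ = 1)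
    {b : OrthonormalBasis (Fin 3) ℝ E3} (hb : b 2 = x) :
    ∃ d₁ d₂ : Fin 3 → ℝ,
      (∀ i, Jet (fun t => energy u m (x + t • b i)) (energy u m x) (d₁ i) (d₂ i)) ∧
      -4 * (energy u m x - potential u x) * energy u m x ≤
        energy u m x * ∑ i, d₂ i - ∑ i, d₁ i ^ 2 := by
  have hx0 : x ≠ 0 := fun h0 => by simp [h0] at hx
  obtain ⟨β₁, β₂, hβ, hβ₁, hβ₂⟩ := h.jet_potential hx b
  have hen : ∀ y, energy u m y = 1 / 4 * (Real.exp (-m y) * (‖y‖ ^ 2 *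
      (dirDeriv (b 0) u y ^ 2 + dirDeriv (b 1) u y ^ 2 + dirDeriv (b 2) u y ^ 2))) +
      potential u y := fun y => by
    rw [energy, ← sum_dirDeriv_sq u y b, Fin.sum_univ_three]
  have hD := fun i j => (h.smooth_u.dirDeriv (b j)).jet hx0 (b i)
  have hj := fun i => ((((h.smooth_m.jet hx0 (b i)).neg.exp).mul ((jet_norm_sq x (b i)).mul
    (((hD i 0).sq.add (hD i 1).sq).add (hD i 2).sq))).const_mul (1 / 4)).add (hβ i)
  simp only [← hen] at hj
  refine ⟨_, _, hj, ?_⟩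
  have hu2 : dirDeriv (b 2) u x = 0 := by rw [hb]; exact h.homog_u.dirDeriv_self h.smooth_u hx0
  have hm2 : dirDeriv (b 2) m x = 0 := by rw [hb]; exact h.homog_m.dirDeriv_self h.smooth_m hx0
  have hu2j : ∀ j, dirDeriv (b 2) (dirDeriv (b j) u) x = -dirDeriv (b j) u x := fun j => by
    nth_rewrite 1 [hb]
    exact h.homog_u.dirDeriv_dirDeriv_self h.smooth_u hx0 _
  have huj2 : ∀ j, dirDeriv (b j) (dirDeriv (b 2) u) x = -dirDeriv (b j) u x := fun j => by
    rw [h.smooth_u.dirDeriv_comm hx0, hu2j]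
  have hu10 : dirDeriv (b 1) (dirDeriv (b 0) u) x = dirDeriv (b 0) (dirDeriv (b 1) u) x :=
    h.smooth_u.dirDeriv_comm hx0 _ _
  have hin : ∀ i, ⟪x, b i⟫_ℝ = if 2 = i then 1 else 0 := fun i => by
    rw [← hb]; exact orthonormalBasis_inner_eq b 2 i
  have hlapu := h.pde_u x hx0
  rw [laplacian_eq_sum h.smooth_u hx0 b, hx, Fin.sum_univ_three, huj2 2, hu2,
    show u x / 2 = 1 / 2 * u x by ring] at hlapu
  have hlapm := h.pde_m x hx0
  rw [laplacian_eq_sum h.smooth_m hx0 b, hx, Fin.sum_univ_three,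
    show u x / 2 = 1 / 2 * u x by ring] at hlapm
  have ht0 := h.sum_third_deriv hx b (v := b 0) (by simp [hin])
  have ht1 := h.sum_third_deriv hx b (v := b 1) (by simp [hin])
  have hgrad := sum_dirDeriv_sq u x b
  rw [Fin.sum_univ_three, hu2] at hgrad
  rw [Fin.sum_univ_three] at ht0 ht1 hβ₂
  rw [← hgrad] at hβ₂
  have hE : Real.exp (-m x) * Real.exp (m x) = 1 := by rw [← Real.exp_add]; simp
  have hnb : ∀ i, ‖b i‖ = 1 := b.orthonormal.1
  have hA : energy u m x - potential u x = 1 / 4 * Real.exp (-m x) *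
      (dirDeriv (b 0) u x ^ 2 + dirDeriv (b 1) u x ^ 2) := by
    rw [hen, hx, hu2]; ring
  have h20 : (2 : Fin 3) ≠ 0 := by decide
  have h21 : (2 : Fin 3) ≠ 1 := by decide
  have key := energy_identity (e := Real.exp (-m x)) (E := Real.exp (m x))
    (p := dirDeriv (b 0) u x) (q := dirDeriv (b 1) u x) (s := dirDeriv (b 0) m x)
    (t := dirDeriv (b 1) m x) (h₀ := dirDeriv (b 0) (dirDeriv (b 0) u) x)
    (h₁ := dirDeriv (b 1) (dirDeriv (b 1) u) x) (k := dirDeriv (b 0) (dirDeriv (b 1) u) x)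
    (sh := Real.sinh (1 / 2 * u x)) (ch := Real.cosh (1 / 2 * u x))
    (A := energy u m x - potential u x) (P := energy u m x) hE (Real.exp_pos _)
    (Real.one_le_cosh _) rfl (by linear_combination hlapu) hA
    (by rw [potential]; ring) rfl rfl rfl
  simp only [Fin.sum_univ_three, hin, hnb, hu2, hm2, huj2, hu2j, hu10, hx, h20, h21, if_true,
    if_false, hβ₁]
  refine key.trans (le_of_eq ?_)
  have hcs := Real.cosh_sq_sub_sinh_sq (1 / 2 * u x)
  rw [potential] at hβ₂
  linear_combination (1 / 4 * energy u m x * Real.exp (-m x) *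
      (dirDeriv (b 0) u x ^ 2 + dirDeriv (b 1) u x ^ 2)) * hlapm
    - (1 / 2 * energy u m x * Real.exp (-m x) * dirDeriv (b 0) u x) * ht0
    - (1 / 2 * energy u m x * Real.exp (-m x) * dirDeriv (b 1) u x) * ht1
    - energy u m x * hβ₂ + 36 * energy u m x * Real.exp (m x) * hcs

end MeanField

namespace MeanField

open Filter Topology ContDiff InnerProductSpace Laplacian

variable {u m : E3 → ℝ}

/-- The squared distance of `y` to the line spanned by the unit vector `p`. -/
noncomputable def gap (p y : E3) : ℝ := ‖y‖ ^ 2 - ⟪y, p⟫_ℝ ^ 2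

theorem gap_of_norm_eq_one (p : E3) {x : E3} (hx : ‖x‖ = 1) : gap p x = 1 - ⟪x, p⟫_ℝ ^ 2 := by
  rw [gap, hx]; ring

theorem gap_smul (p : E3) (c : ℝ) (y : E3) : gap p (c • y) = c ^ 2 * gap p y := by
  rw [gap, gap, norm_smul, inner_smul_left, mul_pow, Real.norm_eq_abs, sq_abs]
  simp only [conj_trivial]
  ring

theorem gap_nonneg {p : E3} (hp : ‖p‖ = 1) (y : E3) : 0 ≤ gap p y := by
  have h := abs_real_inner_le_norm y p
  rw [hp, mul_one] at h
  have := sq_le_sq' (by linarith [neg_abs_le ⟪y, p⟫_ℝ, abs_nonneg ⟪y, p⟫_ℝ, norm_nonneg y])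
    ((le_abs_self _).trans h)
  rw [gap]
  linarith

theorem continuous_gap (p : E3) : Continuous (gap p) := by unfold gap; fun_prop

theorem exists_orthonormalBasis_two_eq {x : E3} (hx : ‖x‖ = 1) :
    ∃ b : OrthonormalBasis (Fin 3) ℝ E3, b 2 = x := by
  have hv : Orthonormal ℝ (({2} : Set (Fin 3)).domRestrict fun _ => x) := by
    refine ⟨fun _ => hx, fun i j hij => (hij (Subsingleton.elim i j)).elim⟩
  obtain ⟨b, hb⟩ := hv.exists_orthonormalBasis_extension_of_card_eq (by simp)
  exact ⟨b, hb 2 rfl⟩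

theorem sum_inner_mul_inner (b : OrthonormalBasis (Fin 3) ℝ E3) (x y : E3) :
    ⟪x, b 0⟫_ℝ * ⟪b 0, y⟫_ℝ + ⟪x, b 1⟫_ℝ * ⟪b 1, y⟫_ℝ + ⟪x, b 2⟫_ℝ * ⟪b 2, y⟫_ℝ = ⟪x, y⟫_ℝ := by
  simpa [Fin.sum_univ_three] using b.sum_inner_mul_inner x y

theorem basis_inner_sums (b : OrthonormalBasis (Fin 3) ℝ E3) {x p : E3} (hx : ‖x‖ = 1)
    (hp : ‖p‖ = 1) :
    ⟪x, b 0⟫_ℝ ^ 2 + ⟪x, b 1⟫_ℝ ^ 2 + ⟪x, b 2⟫_ℝ ^ 2 = 1 ∧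
    ⟪b 0, p⟫_ℝ ^ 2 + ⟪b 1, p⟫_ℝ ^ 2 + ⟪b 2, p⟫_ℝ ^ 2 = 1 ∧
    ⟪x, b 0⟫_ℝ * ⟪b 0, p⟫_ℝ + ⟪x, b 1⟫_ℝ * ⟪b 1, p⟫_ℝ + ⟪x, b 2⟫_ℝ * ⟪b 2, p⟫_ℝ = ⟪x, p⟫_ℝ := by
  refine ⟨?_, ?_, sum_inner_mul_inner b x p⟩
  · have h := sum_inner_mul_inner b x x
    rw [real_inner_self_eq_norm_sq, hx, real_inner_comm x (b 0), real_inner_comm x (b 1),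
      real_inner_comm x (b 2)] at h
    linear_combination h
  · have h := sum_inner_mul_inner b p p
    rw [real_inner_self_eq_norm_sq, hp, real_inner_comm (b 0) p, real_inner_comm (b 1) p,
      real_inner_comm (b 2) p] at h
    linear_combination h

theorem jet_gap (p x v : E3) :
    Jet (fun t : ℝ => gap p (x + t • v)) (gap p x) (2 * ⟪x, v⟫_ℝ - 2 * ⟪x, p⟫_ℝ * ⟪v, p⟫_ℝ)
      (2 * ‖v‖ ^ 2 - 2 * ⟪v, p⟫_ℝ ^ 2) := by
  simpa [gap] using (jet_norm_sq x v).sub (jet_inner x v p).sq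

/-- The function `log (gap p)` is harmonic. -/
theorem jet_log_gap {p : E3} (hp : ‖p‖ = 1) {x : E3} (hx : ‖x‖ = 1) (hg : 0 < gap p x)
    (b : OrthonormalBasis (Fin 3) ℝ E3) :
    ∃ d₁ d₂ : Fin 3 → ℝ,
      (∀ i, Jet (fun t => Real.log (gap p (x + t • b i))) (Real.log (gap p x)) (d₁ i) (d₂ i)) ∧
      ∑ i, d₂ i = 0 := by
  refine ⟨_, _, fun i => (jet_gap p x (b i)).log hg.ne', ?_⟩
  have hnb : ∀ i, ‖b i‖ = 1 := b.orthonormal.1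
  obtain ⟨hxx, hpp, hxp⟩ := basis_inner_sums b hx hp
  have hG := gap_of_norm_eq_one p hx
  simp only [Fin.sum_univ_three, hnb]
  have hc : ∀ c₀ c₁ c₂ d₀ d₁ d₂ : ℝ, c₀ + c₁ + c₂ = 4 → d₀ ^ 2 + d₁ ^ 2 + d₂ ^ 2 = 4 * gap p x →
      c₀ / gap p x - (d₀ / gap p x) ^ 2 + (c₁ / gap p x - (d₁ / gap p x) ^ 2)
        + (c₂ / gap p x - (d₂ / gap p x) ^ 2) = 0 := by
    intro c₀ c₁ c₂ d₀ d₁ d₂ h₁ h₂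
    have hg' := hg.ne'
    field_simp
    linear_combination gap p x * h₁ - h₂
  refine hc _ _ _ _ _ _ ?_ ?_
  · linear_combination -2 * hpp
  · rw [hG]
    linear_combination 4 * hxx + 4 * ⟪x, p⟫_ℝ ^ 2 * hpp - 8 * ⟪x, p⟫_ℝ * hxp

/-- The Laplacian of `log ‖y‖²` at a unit vector. -/
theorem jet_log_norm_sq {x : E3} (hx : ‖x‖ = 1) (b : OrthonormalBasis (Fin 3) ℝ E3) :
    ∃ d₁ d₂ : Fin 3 → ℝ,
      (∀ i, Jet (fun t => Real.log (‖x + t • b i‖ ^ 2)) (Real.log (‖x‖ ^ 2)) (d₁ i) (d₂ i)) ∧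
      ∑ i, d₂ i = 2 := by
  refine ⟨_, _, fun i => (jet_norm_sq x (b i)).log (by rw [hx]; norm_num), ?_⟩
  have hnb : ∀ i, ‖b i‖ = 1 := b.orthonormal.1
  obtain ⟨hxx, -, -⟩ := basis_inner_sums b hx hx
  simp only [Fin.sum_univ_three, hnb, hx]
  linear_combination -4 * hxx

/-- The Laplacian of `⟪y, n⟫² / ‖y‖²` at a unit vector. -/
theorem jet_inner_sq_div {n : E3} (hn : ‖n‖ = 1) {x : E3} (hx : ‖x‖ = 1)
    (b : OrthonormalBasis (Fin 3) ℝ E3) :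
    ∃ d₁ d₂ : Fin 3 → ℝ,
      (∀ i, Jet (fun t => ⟪x + t • b i, n⟫_ℝ ^ 2 * (‖x + t • b i‖ ^ 2)⁻¹)
        (⟪x, n⟫_ℝ ^ 2 * (‖x‖ ^ 2)⁻¹) (d₁ i) (d₂ i)) ∧
      ∑ i, d₂ i = 2 - 6 * ⟪x, n⟫_ℝ ^ 2 := by
  refine ⟨_, _, fun i => (jet_inner x (b i) n).sq.mul
    ((jet_norm_sq x (b i)).inv (by rw [hx]; norm_num)), ?_⟩
  have hnb : ∀ i, ‖b i‖ = 1 := b.orthonormal.1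
  obtain ⟨hxx, hpp, hxp⟩ := basis_inner_sums b hx hn
  simp only [Fin.sum_univ_three, hnb, hx]
  linear_combination 2 * hpp - 8 * ⟪x, n⟫_ℝ * hxp + 8 * ⟪x, n⟫_ℝ ^ 2 * hxx

end MeanField

namespace MeanField

open Filter Topology ContDiff InnerProductSpace Laplacian

variable {u m : E3 → ℝ}

/-- A barrier tending to `-∞` at `±n`, subharmonic on the sphere where `⟪y, n⟫² ≥ 2 / 3`. -/
noncomputable def barrier (n y : E3) : ℝ :=
  Real.log (gap n y) - Real.log (‖y‖ ^ 2) - ⟪y, n⟫_ℝ ^ 2 * (‖y‖ ^ 2)⁻¹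

/-- The weighted energy to which the maximum principle is applied. -/
noncomputable def weighted (u m : E3 → ℝ) (p q n : E3) (k d : ℝ) (y : E3) : ℝ :=
  energy u m y * Real.exp (k * potential u y) * (‖y‖ ^ 2) ^ 2 / (gap p y * gap q y) *
    Real.exp (d * barrier n y)

theorem potential_nonneg (u : E3 → ℝ) (y : E3) : 0 ≤ potential u y := by
  have := Real.one_le_cosh (1 / 2 * u y)
  rw [potential]
  linarith

theorem potential_le_energy (u m : E3 → ℝ) (y : E3) : potential u y ≤ energy u m y := by
  rw [energy]
  have : 0 ≤ 1 / 4 * (Real.exp (-m y) * (‖y‖ ^ 2 * ‖fderiv ℝ u y‖ ^ 2)) := by positivity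
  linarith

theorem energy_nonneg (u m : E3 → ℝ) (y : E3) : 0 ≤ energy u m y :=
  (potential_nonneg u y).trans (potential_le_energy u m y)

theorem IsPair.weighted_not_isLocalMax (h : IsPair u m) {p q n x : E3} (hp : ‖p‖ = 1)
    (hq : ‖q‖ = 1) (hn : ‖n‖ = 1) (hx : ‖x‖ = 1) {k d : ℝ} (hk : 0 < k) (hd : 0 ≤ d)
    (hP : 0 < energy u m x) (hgp : 0 < gap p x) (hgq : 0 < gap q x) (hgn : 0 < gap n x)
    (hdn : d = 0 ∨ 2 / 3 ≤ ⟪x, n⟫_ℝ ^ 2)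
    (hkP : k * (6 * Real.exp (m x) * (Real.cosh (1 / 2 * u x) + 1) * energy u m x) < 4) :
    ¬ IsLocalMax (weighted u m p q n k d) x := by
  intro hmax
  have hx0 : x ≠ 0 := fun h0 => by simp [h0] at hx
  obtain ⟨b, hb⟩ := exists_orthonormalBasis_two_eq hx
  obtain ⟨P₁, P₂, hPj, hPin⟩ := h.jet_energy hx hb
  obtain ⟨B₁, B₂, hBj, -, hBs⟩ := h.jet_potential hx b
  obtain ⟨G₁, G₂, hGj, hGs⟩ := jet_log_gap hp hx hgp b
  obtain ⟨Q₁, Q₂, hQj, hQs⟩ := jet_log_gap hq hx hgq b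
  obtain ⟨N₁, N₂, hNj, hNs⟩ := jet_log_gap hn hx hgn b
  obtain ⟨R₁, R₂, hRj, hRs⟩ := jet_log_norm_sq hx b
  obtain ⟨S₁, S₂, hSj, hSs⟩ := jet_inner_sq_div hn hx b
  have hj := fun i => (((((hPj i).log hP.ne').add ((hBj i).const_mul k)).add
    ((hRj i).const_mul 2)).sub ((hGj i).add (hQj i))).add
    ((((hNj i).sub (hRj i)).sub (hSj i)).const_mul d)
  have hle : ∀ i, _ ≤ (0 : ℝ) := fun i => (hj i).nonpos_of_isLocalMax (by
    have hcont : Tendsto (fun t : ℝ => x + t • b i) (𝓝 0) (𝓝 x) := by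
      have := (hasDerivAt_line x (b i) 0).continuousAt.tendsto
      simpa using this
    have e₁ := (hPj i).tendsto.eventually (lt_mem_nhds hP)
    have e₂ := (jet_gap p x (b i)).tendsto.eventually (lt_mem_nhds hgp)
    have e₃ := (jet_gap q x (b i)).tendsto.eventually (lt_mem_nhds hgq)
    have e₄ := hcont.eventually (eventually_ne_nhds hx0)
    have e₅ := hcont.eventually hmax
    have key : ∀ y : E3, y ≠ 0 → 0 < energy u m y → 0 < gap p y → 0 < gap q y →
        Real.log (weighted u m p q n k d y) =
          Real.log (energy u m y) + k * potential u y + 2 * Real.log (‖y‖ ^ 2) -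
            (Real.log (gap p y) + Real.log (gap q y)) +
            d * (Real.log (gap n y) - Real.log (‖y‖ ^ 2) -
              ⟪y, n⟫_ℝ ^ 2 * (‖y‖ ^ 2)⁻¹) := by
      intro y hy h₁ h₂ h₃
      have hny : ‖y‖ ^ 2 ≠ 0 := pow_ne_zero 2 (norm_ne_zero_iff.mpr hy)
      rw [weighted, Real.log_mul (by positivity) (by positivity), Real.log_div (by positivity)
        (by positivity), Real.log_mul (by positivity) (by positivity), Real.log_mul (by positivity)
        (by positivity), Real.log_mul (by positivity) (by positivity), Real.log_exp, Real.log_exp,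
        Real.log_pow (n := 2) (x := ‖y‖ ^ 2), barrier]
      push_cast
      ring
    have hpos : ∀ y : E3, y ≠ 0 → 0 < energy u m y → 0 < gap p y → 0 < gap q y →
        0 < weighted u m p q n k d y := by
      intro y hy h₁ h₂ h₃
      have hny : 0 < ‖y‖ := norm_pos_iff.mpr hy
      unfold weighted
      positivity
    change ∀ᶠ t in 𝓝 (0 : ℝ), _ ≤ _
    filter_upwards [e₁, e₂, e₃, e₄, e₅] with t h₁ h₂ h₃ h₄ h₅
    simp only [zero_smul, add_zero]
    rw [← key _ h₄ h₁ h₂ h₃, ← key x hx0 hP hgp hgq]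
    exact Real.log_le_log (hpos _ h₄ h₁ h₂ h₃) h₅)
  have hsum := Finset.sum_nonpos fun i (_ : i ∈ Finset.univ) => hle i
  simp only [Fin.sum_univ_three] at hsum hPin hBs hGs hQs hNs hRs hSs
  set P := energy u m x with hPdef
  set B := potential u x with hBdef
  have hBP : B ≤ P := potential_le_energy u m x
  have hB0 : 0 ≤ B := potential_nonneg u x
  have hlog : -4 * (P - B) / P ≤ P₂ 0 / P - (P₁ 0 / P) ^ 2 + (P₂ 1 / P - (P₁ 1 / P) ^ 2)
      + (P₂ 2 / P - (P₁ 2 / P) ^ 2) := by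
    have : P₂ 0 / P - (P₁ 0 / P) ^ 2 + (P₂ 1 / P - (P₁ 1 / P) ^ 2)
      + (P₂ 2 / P - (P₁ 2 / P) ^ 2) = (P * (P₂ 0 + P₂ 1 + P₂ 2) -
        (P₁ 0 ^ 2 + P₁ 1 ^ 2 + P₁ 2 ^ 2)) / P ^ 2 := by
      field_simp
      ring
    rw [this, le_div_iff₀ (by positivity)]
    refine le_trans (le_of_eq ?_) hPin
    field_simp
  have hd' : 0 ≤ d * (6 * ⟪x, n⟫_ℝ ^ 2 - 4) := by
    rcases hdn with rfl | h'
    · simp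
    · exact mul_nonneg hd (by linarith)
  have hch := Real.cosh_pos (1 / 2 * u x)
  have hE := Real.exp_pos (m x)
  have hfin : 4 * B / P + k * (3 / 2 * Real.cosh (1 / 2 * u x) * ‖fderiv ℝ u x‖ ^ 2 -
        6 * Real.exp (m x) * (Real.cosh (1 / 2 * u x) + 1) * B) ≤ 0 := by
    have h4 : -4 * (P - B) / P = 4 * B / P - 4 := by field_simp; ring
    rw [h4] at hlog
    rw [← hBs]
    linear_combination hsum + hlog + hd' + (d - 2) * hRs + hGs + hQs - d * hNs + d * hSs
  have hfac : 4 * B / P - k * (6 * Real.exp (m x) * (Real.cosh (1 / 2 * u x) + 1) * B) =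
      B / P * (4 - k * (6 * Real.exp (m x) * (Real.cosh (1 / 2 * u x) + 1) * P)) := by
    field_simp
  rcases hB0.lt_or_eq with hBpos | hB
  · have h1 : 0 < B / P * (4 - k * (6 * Real.exp (m x) * (Real.cosh (1 / 2 * u x) + 1) * P)) :=
      mul_pos (div_pos hBpos hP) (by linarith)
    have h2 : 0 ≤ k * (3 / 2 * Real.cosh (1 / 2 * u x) * ‖fderiv ℝ u x‖ ^ 2) := by positivity
    linarith
  · have hf : 0 < ‖fderiv ℝ u x‖ ^ 2 := by
      by_contra! hcon
      have h0 : ‖fderiv ℝ u x‖ ^ 2 = 0 := le_antisymm hcon (by positivity)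
      have : P = 0 := by rw [hPdef, energy, h0, ← hBdef, ← hB]; ring
      exact hP.ne' this
    rw [← hB] at hfin
    have : 0 < k * (3 / 2 * Real.cosh (1 / 2 * u x) * ‖fderiv ℝ u x‖ ^ 2) := by positivity
    simp only [mul_zero, zero_div] at hfin
    linarith

end MeanField

namespace MeanField

open Filter Topology ContDiff InnerProductSpace Laplacian

variable {u m : E3 → ℝ}

theorem norm_inv_norm_smul {y : E3} (hy : y ≠ 0) : ‖‖y‖⁻¹ • y‖ = 1 := by
  rw [norm_smul, norm_inv, norm_norm, inv_mul_cancel₀ (norm_ne_zero_iff.mpr hy)]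

theorem ne_zero_of_norm_eq_one {x : E3} (hx : ‖x‖ = 1) : x ≠ 0 := fun h0 => by simp [h0] at hx

theorem isLocalMax_of_sphere {F : E3 → ℝ} {z : E3} (hz : ‖z‖ = 1)
    (hF : ∀ᶠ y in 𝓝 z, F (‖y‖⁻¹ • y) = F y) (hmax : ∀ᶠ x in 𝓝 z, ‖x‖ = 1 → F x ≤ F z) :
    IsLocalMax F z := by
  have hz0 := ne_zero_of_norm_eq_one hz
  have hcont : Tendsto (fun y : E3 => ‖y‖⁻¹ • y) (𝓝 z) (𝓝 z) := by
    have : ContinuousAt (fun y : E3 => ‖y‖⁻¹ • y) z :=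
      (continuousAt_id.norm.inv₀ (norm_ne_zero_iff.mpr hz0)).smul continuousAt_id
    simpa [ContinuousAt, hz] using this
  filter_upwards [hF, hcont.eventually hmax, eventually_ne_nhds hz0] with y h₁ h₂ h₃
  rw [← h₁]
  exact h₂ (norm_inv_norm_smul h₃)

theorem IsPair.energy_smul (h : IsPair u m) {c : ℝ} (hc : 0 < c) (y : E3) :
    energy u m (c • y) = energy u m y := by
  have hf : fderiv ℝ u (c • y) = c⁻¹ • fderiv ℝ u y := by
    ext v
    exact h.homog_u.dirDeriv_smul hc v y
  rw [energy, energy, potential, potential, hf, h.homog_u c hc, h.homog_m c hc, norm_smul,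
    norm_smul, norm_inv, Real.norm_of_nonneg hc.le]
  field_simp

theorem IsPair.weighted_smul (h : IsPair u m) {p q n : E3} {k d c : ℝ} (hc : 0 < c) {y : E3}
    (hy : y ≠ 0) (hg : gap n y ≠ 0) :
    weighted u m p q n k d (c • y) = weighted u m p q n k d y := by
  have hy' : ‖y‖ ≠ 0 := norm_ne_zero_iff.mpr hy
  have hb : barrier n (c • y) = barrier n y := by
    rw [barrier, barrier, gap_smul, norm_smul, inner_smul_left, mul_pow, Real.norm_of_nonneg hc.le,
      Real.log_mul (by positivity) hg, Real.log_mul (by positivity) (by positivity)]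
    simp only [conj_trivial]
    field_simp
    ring
  rw [weighted, weighted, h.energy_smul hc, potential, potential, h.homog_u c hc, hb, gap_smul,
    gap_smul, norm_smul, Real.norm_of_nonneg hc.le]
  congr 1
  rw [show c ^ 2 * gap p y * (c ^ 2 * gap q y) = c ^ 4 * (gap p y * gap q y) by ring,
    show energy u m y * Real.exp (k * (6 * (Real.cosh (1 / 2 * u y) - 1))) * ((c * ‖y‖) ^ 2) ^ 2 =
      c ^ 4 * (energy u m y * Real.exp (k * (6 * (Real.cosh (1 / 2 * u y) - 1))) * (‖y‖ ^ 2) ^ 2)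
      by ring, mul_div_mul_left _ _ (by positivity)]

theorem SmoothOff.continuousAt_fderiv {f : E3 → ℝ} (hf : SmoothOff f) {y : E3} (hy : y ≠ 0) :
    ContinuousAt (fderiv ℝ f) y :=
  ((hf y hy).fderiv_right (m := 0) (by norm_cast)).continuousAt

theorem continuousAt_potential (hu : SmoothOff u) {y : E3} (hy : y ≠ 0) :
    ContinuousAt (potential u) y := by
  have := hu.continuousAt hy
  unfold potential
  fun_prop

theorem IsPair.continuousAt_energy (h : IsPair u m) {y : E3} (hy : y ≠ 0) :
    ContinuousAt (energy u m) y := by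
  have h₁ := h.smooth_m.continuousAt hy
  have h₂ := continuousAt_potential h.smooth_u hy
  have h₃ := h.smooth_u.continuousAt_fderiv hy
  unfold energy
  fun_prop

theorem IsPair.continuousAt_weighted (h : IsPair u m) {p q n : E3} {k d : ℝ} {y : E3}
    (hy : y ≠ 0) (hp : gap p y ≠ 0) (hq : gap q y ≠ 0) (hn : gap n y ≠ 0) :
    ContinuousAt (weighted u m p q n k d) y := by
  have h₁ := h.continuousAt_energy hy
  have h₂ := continuousAt_potential h.smooth_u hy
  have hny : ‖y‖ ^ 2 ≠ 0 := pow_ne_zero 2 (norm_ne_zero_iff.mpr hy)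
  have h₃ : ContinuousAt (barrier n) y := by
    have hl : ContinuousAt (fun y => Real.log (gap n y)) y :=
      (continuous_gap n).continuousAt.log hn
    have hl' : ContinuousAt (fun y : E3 => Real.log (‖y‖ ^ 2)) y :=
      (continuous_norm.pow 2).continuousAt.log hny
    have hi : ContinuousAt (fun y : E3 => (‖y‖ ^ 2)⁻¹) y :=
      (continuous_norm.pow 2).continuousAt.inv₀ hny
    unfold barrier
    fun_prop
  have h₄ : ContinuousAt (fun y => energy u m y * Real.exp (k * potential u y) * (‖y‖ ^ 2) ^ 2 /
      (gap p y * gap q y)) y :=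
    ContinuousAt.div (by fun_prop)
      ((continuous_gap p).mul (continuous_gap q)).continuousAt (mul_ne_zero hp hq)
  unfold weighted
  fun_prop

/-- If a weighted energy without barrier is bounded by `M` on the circles `⟪x, n⟫² = c`, then it is
bounded by `M` on the punctured polar caps bounded by these circles. -/
theorem IsPair.weighted_le_of_cap (h : IsPair u m) {p q n : E3} (hp : ‖p‖ = 1) (hq : ‖q‖ = 1)
    (hn : ‖n‖ = 1) {k c M C : ℝ} (hk : 0 < k) (hc : 2 / 3 ≤ c) (hM : 0 ≤ M)
    (hkP : ∀ x, ‖x‖ = 1 →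
      k * (6 * Real.exp (m x) * (Real.cosh (1 / 2 * u x) + 1) * energy u m x) < 4)
    (hgap : ∀ x, ‖x‖ = 1 → c ≤ ⟪x, n⟫_ℝ ^ 2 → 0 < gap n x → 0 < gap p x ∧ 0 < gap q x)
    (hC : ∀ x, ‖x‖ = 1 → 0 < gap p x → 0 < gap q x → weighted u m p q n k 0 x ≤ C)
    (hbd : ∀ x, ‖x‖ = 1 → ⟪x, n⟫_ℝ ^ 2 = c → 0 < gap n x → weighted u m p q n k 0 x ≤ M)
    {y : E3} (hy : ‖y‖ = 1) (hcy : c ≤ ⟪y, n⟫_ℝ ^ 2) (hny : 0 < gap n y) :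
    weighted u m p q n k 0 y ≤ M := by
  by_contra! hlt
  have hw : ∀ (d : ℝ) (x : E3), weighted u m p q n k d x =
      weighted u m p q n k 0 x * Real.exp (d * barrier n x) := fun d x => by
    simp [weighted]
  have hbar : ∀ x : E3, ‖x‖ = 1 → barrier n x = Real.log (gap n x) - ⟪x, n⟫_ℝ ^ 2 := fun x hx => by
    simp [barrier, hx]
  have hc1 : c < 1 := by
    rw [gap_of_norm_eq_one n hy] at hny
    linarith
  obtain ⟨Hc, hHc⟩ : ∃ Hc, Hc = Real.log (1 - c) - c := ⟨_, rfl⟩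
  -- choose the weight of the barrier
  obtain ⟨d, hd, hdM⟩ : ∃ d : ℝ, 0 < d ∧
      M * Real.exp (d * Hc) < weighted u m p q n k 0 y * Real.exp (d * barrier n y) := by
    have hcont : ContinuousAt (fun d : ℝ => weighted u m p q n k 0 y * Real.exp (d * barrier n y) -
        M * Real.exp (d * Hc)) 0 := by fun_prop
    have := hcont.eventually (lt_mem_nhds (a := 0) (by simpa using hlt))
    obtain ⟨d, hd, hd0⟩ := ((this.filter_mono nhdsWithin_le_nhds).and
      (self_mem_nhdsWithin (a := (0 : ℝ)) (s := Set.Ioi 0))).exists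
    exact ⟨d, hd0, by linarith⟩
  have hvpos : 0 < weighted u m p q n k 0 y * Real.exp (d * barrier n y) :=
    lt_of_le_of_lt (by positivity) hdM
  -- choose the inner radius
  obtain ⟨ε, hε, hεy, hεv⟩ : ∃ ε : ℝ, 0 < ε ∧ ε < gap n y ∧
      C * Real.exp (d * Real.log ε) < weighted u m p q n k 0 y * Real.exp (d * barrier n y) := by
    have h1 : Tendsto (fun ε : ℝ => C * Real.exp (d * Real.log ε)) (𝓝[>] 0) (𝓝 (C * 0)) :=
      (Real.tendsto_exp_atBot.comp (Real.tendsto_log_nhdsGT_zero.const_mul_atBot hd)).const_mul C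
    rw [mul_zero] at h1
    obtain ⟨ε, h₁, h₂, h₃⟩ := ((h1.eventually (gt_mem_nhds hvpos)).and
      ((eventually_mem_nhdsWithin).and
        ((gt_mem_nhds hny).filter_mono nhdsWithin_le_nhds))).exists
    exact ⟨ε, h₂, h₃, h₁⟩
  have hcl : IsClosed {x : E3 | ‖x‖ = 1 ∧ c ≤ ⟪x, n⟫_ℝ ^ 2 ∧ ε ≤ gap n x} := by
    have h1 : IsClosed {x : E3 | ‖x‖ = 1} := isClosed_eq continuous_norm continuous_const
    have h2 : IsClosed {x : E3 | c ≤ ⟪x, n⟫_ℝ ^ 2} := isClosed_le continuous_const (by fun_prop)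
    have h3 : IsClosed {x : E3 | ε ≤ gap n x} := isClosed_le continuous_const (continuous_gap n)
    exact h1.inter (h2.inter h3)
  have hne : {x : E3 | ‖x‖ = 1 ∧ c ≤ ⟪x, n⟫_ℝ ^ 2 ∧ ε ≤ gap n x}.Nonempty := ⟨y, hy, hcy, hεy.le⟩
  obtain ⟨z, ⟨hz, hzc, hzε⟩, hzmax⟩ : ∃ z ∈ {x : E3 | ‖x‖ = 1 ∧ c ≤ ⟪x, n⟫_ℝ ^ 2 ∧ ε ≤ gap n x},
      IsMaxOn (weighted u m p q n k d)
        {x : E3 | ‖x‖ = 1 ∧ c ≤ ⟪x, n⟫_ℝ ^ 2 ∧ ε ≤ gap n x} z := by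
    refine IsCompact.exists_isMaxOn ?_ hne ?_
    · exact (isCompact_sphere (0 : E3) 1).of_isClosed_subset hcl fun x hx => by simpa using hx.1
    · rintro x ⟨hx, hxc, hxε⟩
      have hgn : 0 < gap n x := hε.trans_le hxε
      obtain ⟨hgp, hgq⟩ := hgap x hx hxc hgn
      exact (h.continuousAt_weighted (ne_zero_of_norm_eq_one hx) hgp.ne' hgq.ne'
        hgn.ne').continuousWithinAt
  have hzy : weighted u m p q n k 0 y * Real.exp (d * barrier n y) ≤ weighted u m p q n k d z := by
    rw [← hw]
    exact hzmax ⟨hy, hcy, hεy.le⟩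
  have hgn : 0 < gap n z := hε.trans_le hzε
  obtain ⟨hgp, hgq⟩ := hgap z hz hzc hgn
  have hzc' : c < ⟪z, n⟫_ℝ ^ 2 := by
    refine lt_of_le_of_ne hzc fun heq => ?_
    have h1 := hbd z hz heq.symm hgn
    have h2 : barrier n z = Hc := by
      rw [hbar z hz, gap_of_norm_eq_one n hz, ← heq, hHc]
    rw [hw d z, h2] at hzy
    have := mul_le_mul_of_nonneg_right h1 (Real.exp_pos (d * Hc)).le
    linarith
  have hzε' : ε < gap n z := by
    refine lt_of_le_of_ne hzε fun heq => ?_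
    have h1 := hC z hz hgp hgq
    have h2 : barrier n z ≤ Real.log ε := by
      rw [hbar z hz, ← heq]
      linarith [sq_nonneg ⟪z, n⟫_ℝ]
    have h3 : Real.exp (d * barrier n z) ≤ Real.exp (d * Real.log ε) :=
      Real.exp_le_exp.mpr (mul_le_mul_of_nonneg_left h2 hd.le)
    have h4 : 0 ≤ weighted u m p q n k 0 z := by
      have := energy_nonneg u m z
      unfold weighted
      positivity
    rw [hw d z] at hzy
    have := mul_le_mul h1 h3 (Real.exp_pos _).le (h4.trans h1)
    linarith
  have hPz : 0 < energy u m z := by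
    refine lt_of_le_of_ne (energy_nonneg u m z) fun heq => ?_
    have : weighted u m p q n k d z = 0 := by simp [weighted, ← heq]
    linarith
  refine h.weighted_not_isLocalMax hp hq hn hz hk hd.le hPz hgp hgq hgn
    (Or.inr (hc.trans hzc)) (hkP z hz) (isLocalMax_of_sphere hz ?_ ?_)
  · filter_upwards [eventually_ne_nhds (ne_zero_of_norm_eq_one hz),
      (continuous_gap n).continuousAt.eventually (lt_mem_nhds hgn)] with x hx0 hxg
    exact h.weighted_smul (inv_pos.mpr (norm_pos_iff.mpr hx0)) hx0 hxg.ne'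
  · have hcont : ContinuousAt (fun x : E3 => ⟪x, n⟫_ℝ ^ 2) z := by fun_prop
    filter_upwards [hcont.eventually (lt_mem_nhds hzc'),
      (continuous_gap n).continuousAt.eventually (lt_mem_nhds hzε')] with x h₁ h₂ h₃
    exact hzmax ⟨h₃, h₁.le, h₂.le⟩

/-- The energy vanishes identically if it vanishes to sufficiently high order at some nodes. -/
theorem IsPair.eq_zero_of_energy_le (h : IsPair u m) {p q : E3} (hp : ‖p‖ = 1) (hq : ‖q‖ = 1)
    {c C : ℝ} (hc : 2 / 3 ≤ c) (hc1 : c < 1)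
    (hpq : ∀ x : E3, ‖x‖ = 1 → c ≤ ⟪x, p⟫_ℝ ^ 2 → ⟪x, q⟫_ℝ ^ 2 ≤ c ∨ ⟪x, q⟫_ℝ ^ 2 = ⟪x, p⟫_ℝ ^ 2)
    (hqp : ∀ x : E3, ‖x‖ = 1 → c ≤ ⟪x, q⟫_ℝ ^ 2 → ⟪x, p⟫_ℝ ^ 2 ≤ c ∨ ⟪x, p⟫_ℝ ^ 2 = ⟪x, q⟫_ℝ ^ 2)
    (hC : ∀ x, ‖x‖ = 1 → energy u m x ≤ C * (gap p x * gap q x)) {x : E3} (hx : ‖x‖ = 1) :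
    u x = 0 := by
  by_contra hux
  have hPx : 0 < energy u m x := by
    refine lt_of_lt_of_le ?_ (potential_le_energy u m x)
    have : 1 < Real.cosh (1 / 2 * u x) := Real.one_lt_cosh.mpr (by simpa using hux)
    rw [potential]
    linarith
  have hsph : ∀ y : E3, y ∈ Metric.sphere (0 : E3) 1 ↔ ‖y‖ = 1 := fun y => by simp
  have hgx : 0 < gap p x ∧ 0 < gap q x := by
    have h1 := (hPx.trans_le (hC x hx))
    constructor
    · refine lt_of_le_of_ne (gap_nonneg hp x) fun heq => ?_
      simp [← heq] at h1
    · refine lt_of_le_of_ne (gap_nonneg hq x) fun heq => ?_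
      simp [← heq] at h1
  have hbound : ∀ f : E3 → ℝ, (∀ y, y ≠ 0 → ContinuousAt f y) →
      ∃ M, 0 ≤ M ∧ ∀ y, ‖y‖ = 1 → f y ≤ M := fun f hf => by
    obtain ⟨z, -, hz⟩ := (isCompact_sphere (0 : E3) 1).exists_isMaxOn ⟨x, (hsph x).mpr hx⟩
      (f := f) fun y hy =>
        (hf y (ne_zero_of_norm_eq_one ((hsph y).mp hy))).continuousWithinAt
    exact ⟨max 0 (f z), le_max_left _ _, fun y hy => (hz ((hsph y).mpr hy)).trans (le_max_right _ _)⟩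
  obtain ⟨M₁, hM₁, hM₁'⟩ := hbound
    (fun x => 6 * Real.exp (m x) * (Real.cosh (1 / 2 * u x) + 1) * energy u m x) fun y hy => by
      have h₁ := h.continuousAt_energy hy
      have h₂ := h.smooth_u.continuousAt hy
      have h₃ := h.smooth_m.continuousAt hy
      fun_prop
  obtain ⟨k, hk, hkP⟩ : ∃ k : ℝ, 0 < k ∧ ∀ x, ‖x‖ = 1 →
      k * (6 * Real.exp (m x) * (Real.cosh (1 / 2 * u x) + 1) * energy u m x) < 4 := by
    refine ⟨(1 + M₁)⁻¹, by positivity, fun y hy => ?_⟩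
    rw [inv_mul_lt_iff₀ (by positivity)]
    linarith [hM₁' y hy]
  obtain ⟨M₂, hM₂, hM₂'⟩ := hbound (potential u) fun y hy => continuousAt_potential h.smooth_u hy
  have hC' : ∀ (n x : E3), ‖x‖ = 1 → 0 < gap p x → 0 < gap q x →
      weighted u m p q n k 0 x ≤ C * Real.exp (k * M₂) := by
    intro n y hy h₁ h₂
    have h0 : 0 ≤ energy u m y := energy_nonneg u m y
    have h3 : energy u m y / (gap p y * gap q y) ≤ C := (div_le_iff₀ (by positivity)).mpr (hC y hy)
    have h4 : weighted u m p q n k 0 y =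
        energy u m y / (gap p y * gap q y) * Real.exp (k * potential u y) := by
      simp only [weighted, hy, zero_mul, Real.exp_zero]
      ring
    have h5 : 0 ≤ energy u m y / (gap p y * gap q y) := by positivity
    rw [h4]
    exact mul_le_mul h3 (Real.exp_le_exp.mpr (mul_le_mul_of_nonneg_left (hM₂' y hy) hk.le))
      (Real.exp_pos _).le (h5.trans h3)
  have hind : ∀ n y, weighted u m p q n k 0 y = weighted u m p q p k 0 y := fun n y => by
    simp [weighted]
  have hgc : ∀ (n x : E3), ‖x‖ = 1 → ⟪x, n⟫_ℝ ^ 2 ≤ c → 0 < gap n x := fun n x hx hxc => by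
    rw [gap_of_norm_eq_one n hx]
    linarith
  have hcl : IsClosed {x : E3 | ‖x‖ = 1 ∧ ⟪x, p⟫_ℝ ^ 2 ≤ c ∧ ⟪x, q⟫_ℝ ^ 2 ≤ c} := by
    have h1 : IsClosed {x : E3 | ‖x‖ = 1} := isClosed_eq continuous_norm continuous_const
    have h2 : IsClosed {x : E3 | ⟪x, p⟫_ℝ ^ 2 ≤ c} := isClosed_le (by fun_prop) continuous_const
    have h3 : IsClosed {x : E3 | ⟪x, q⟫_ℝ ^ 2 ≤ c} := isClosed_le (by fun_prop) continuous_const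
    exact h1.inter (h2.inter h3)
  have hcpt : IsCompact {x : E3 | ‖x‖ = 1 ∧ ⟪x, p⟫_ℝ ^ 2 ≤ c ∧ ⟪x, q⟫_ℝ ^ 2 ≤ c} :=
    (isCompact_sphere (0 : E3) 1).of_isClosed_subset hcl fun x hx => by simpa using hx.1
  have hcts : ContinuousOn (weighted u m p q p k 0)
      {x : E3 | ‖x‖ = 1 ∧ ⟪x, p⟫_ℝ ^ 2 ≤ c ∧ ⟪x, q⟫_ℝ ^ 2 ≤ c} := by
    rintro y ⟨hy, hyp, hyq⟩
    exact (h.continuousAt_weighted (ne_zero_of_norm_eq_one hy) (hgc p y hy hyp).ne'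
      (hgc q y hy hyq).ne' (hgc p y hy hyp).ne').continuousWithinAt
  have hwnn : ∀ y, ‖y‖ = 1 → 0 ≤ weighted u m p q p k 0 y := fun y hy => by
    have h1 := energy_nonneg u m y
    have h2 := gap_nonneg hp y
    have h3 := gap_nonneg hq y
    unfold weighted
    positivity
  obtain ⟨M, hM, hMle, hMeq⟩ : ∃ M, 0 ≤ M ∧ (∀ y : E3, ‖y‖ = 1 → ⟪y, p⟫_ℝ ^ 2 ≤ c →
      ⟪y, q⟫_ℝ ^ 2 ≤ c → weighted u m p q p k 0 y ≤ M) ∧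
      (M = 0 ∨ ∃ z : E3, ‖z‖ = 1 ∧ ⟪z, p⟫_ℝ ^ 2 ≤ c ∧ ⟪z, q⟫_ℝ ^ 2 ≤ c ∧
        weighted u m p q p k 0 z = M) := by
    rcases Set.eq_empty_or_nonempty
      {x : E3 | ‖x‖ = 1 ∧ ⟪x, p⟫_ℝ ^ 2 ≤ c ∧ ⟪x, q⟫_ℝ ^ 2 ≤ c} with hemp | hne
    · refine ⟨0, le_rfl, fun y h₁ h₂ h₃ => ?_, Or.inl rfl⟩
      exact (Set.eq_empty_iff_forall_notMem.mp hemp y ⟨h₁, h₂, h₃⟩).elim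
    · obtain ⟨z, ⟨hz, hzp, hzq⟩, hzmax⟩ := hcpt.exists_isMaxOn hne hcts
      exact ⟨weighted u m p q p k 0 z, hwnn z hz, fun y h₁ h₂ h₃ => hzmax ⟨h₁, h₂, h₃⟩,
        Or.inr ⟨z, hz, hzp, hzq, rfl⟩⟩
  have hall : ∀ y, ‖y‖ = 1 → 0 < gap p y → 0 < gap q y → weighted u m p q p k 0 y ≤ M := by
    intro y hy hgp hgq
    by_cases hyp : ⟪y, p⟫_ℝ ^ 2 ≤ c
    · by_cases hyq : ⟪y, q⟫_ℝ ^ 2 ≤ c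
      · exact hMle y hy hyp hyq
      · rw [← hind q]
        refine h.weighted_le_of_cap hp hq hq hk hc hM hkP ?_ (hC' q) ?_ hy (not_le.mp hyq).le hgq
        · intro x hx hxc hxq
          refine ⟨?_, hxq⟩
          rcases hqp x hx hxc with h' | h'
          · exact hgc p x hx h'
          · rw [gap_of_norm_eq_one _ hx] at hxq ⊢
            rwa [h']
        · intro x hx hxc hxq
          rw [hind]
          refine hMle x hx ?_ hxc.le
          rcases hqp x hx hxc.ge with h' | h'
          · exact h'
          · rw [h', hxc]
    · refine h.weighted_le_of_cap hp hq hp hk hc hM hkP ?_ (hC' p) ?_ hy (not_le.mp hyp).le hgp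
      · intro x hx hxc hxp
        refine ⟨hxp, ?_⟩
        rcases hpq x hx hxc with h' | h'
        · exact hgc q x hx h'
        · rw [gap_of_norm_eq_one _ hx] at hxp ⊢
          rwa [h']
      · intro x hx hxc hxp
        refine hMle x hx hxc.le ?_
        rcases hpq x hx hxc.ge with h' | h'
        · exact h'
        · rw [h', hxc]
  have hMpos : 0 < M := by
    refine lt_of_lt_of_le ?_ (hall x hx hgx.1 hgx.2)
    have := hgx.1
    have := hgx.2
    simp only [weighted, hx]
    positivity
  rcases hMeq with h0 | ⟨z, hz, hzp, hzq, hzM⟩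
  · exact hMpos.ne' h0
  have hgp := hgc p z hz hzp
  have hgq := hgc q z hz hzq
  have hPz : 0 < energy u m z := by
    refine lt_of_le_of_ne (energy_nonneg u m z) fun heq => ?_
    have : weighted u m p q p k 0 z = 0 := by simp [weighted, ← heq]
    linarith
  have e₁ := (continuous_gap p).continuousAt.eventually (lt_mem_nhds hgp)
  have e₂ := (continuous_gap q).continuousAt.eventually (lt_mem_nhds hgq)
  refine h.weighted_not_isLocalMax hp hq hp hz hk le_rfl hPz hgp hgq hgp
    (Or.inl rfl) (hkP z hz) (isLocalMax_of_sphere hz ?_ ?_)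
  · filter_upwards [eventually_ne_nhds (ne_zero_of_norm_eq_one hz), e₁] with x hx0 hxg
    exact h.weighted_smul (inv_pos.mpr (norm_pos_iff.mpr hx0)) hx0 hxg.ne'
  · filter_upwards [e₁, e₂] with y h₁ h₂ h₃
    rw [hzM]
    exact hall y h₃ h₁ h₂

end MeanField

namespace MeanField

open Filter Topology ContDiff InnerProductSpace Laplacian Asymptotics

variable {u m : E3 → ℝ}

theorem isBigO_sub_sq {E F : Type*} [NormedAddCommGroup E] [NormedSpace ℝ E]
    [NormedAddCommGroup F] [NormedSpace ℝ F] {f : E → F} {a : E} (hf : ContDiffAt ℝ 2 f a)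
    (h0 : f a = 0) (h1 : fderiv ℝ f a = 0) : f =O[𝓝 a] fun x => ‖x - a‖ ^ 2 := by
  have hd : DifferentiableAt ℝ (fderiv ℝ f) a :=
    (hf.fderiv_right (m := 1) (by norm_num)).differentiableAt (by norm_num)
  obtain ⟨C, hC⟩ := hd.hasFDerivAt.isBigO_sub.bound
  have hev : ∀ᶠ x in 𝓝 a, DifferentiableAt ℝ f x ∧ ‖fderiv ℝ f x - fderiv ℝ f a‖ ≤ C * ‖x - a‖ := by
    filter_upwards [hC, hf.eventually (by simp)] with x h₁ h₂
    exact ⟨h₂.differentiableAt (by norm_num), h₁⟩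
  obtain ⟨r, hr, hball⟩ := Metric.eventually_nhds_iff.mp hev
  have hC0 : ∀ y, dist y a < r → ‖fderiv ℝ f y‖ ≤ |C| * ‖y - a‖ := fun y hy => by
    have := (hball hy).2
    rw [h1, sub_zero] at this
    exact this.trans (by gcongr; exact le_abs_self C)
  refine IsBigO.of_bound |C| ?_
  filter_upwards [Metric.ball_mem_nhds a hr] with x hx
  have hx' : ‖x - a‖ < r := by simpa [dist_eq_norm] using hx
  have hle := (convex_closedBall a ‖x - a‖).norm_image_sub_le_of_norm_hasFDerivWithin_le
    (f := f) (f' := fderiv ℝ f) (C := |C| * ‖x - a‖) (x := a) (y := x)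
    (fun y hy => (hball (by
      rw [mem_closedBall_iff_norm] at hy
      rw [dist_eq_norm]; linarith)).1.hasFDerivAt.hasFDerivWithinAt)
    (fun y hy => by
      rw [mem_closedBall_iff_norm] at hy
      refine (hC0 y (by rw [dist_eq_norm]; linarith)).trans (by gcongr))
    (by simp) (by simp [dist_eq_norm])
  rw [h0, sub_zero] at hle
  rw [Real.norm_of_nonneg (by positivity)]
  calc _ ≤ _ := hle
    _ = _ := by ring

theorem IsPair.energy_isBigO (h : IsPair u m) {n : E3} (hn : n ≠ 0) {k : ℕ} (hk : k ≠ 0)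
    (hu : u =O[𝓝 n] fun x => ‖x - n‖ ^ k)
    (hdu : fderiv ℝ u =O[𝓝 n] fun x => ‖x - n‖ ^ k) :
    energy u m =O[𝓝 n] fun x => (‖x - n‖ ^ k) ^ 2 := by
  have h1 : (fun y => Real.exp (-m y) * (‖y‖ ^ 2 * ‖fderiv ℝ u y‖ ^ 2)) =O[𝓝 n]
      fun x => (‖x - n‖ ^ k) ^ 2 := by
    have hc : (fun y => Real.exp (-m y)) =O[𝓝 n] fun _ => (1 : ℝ) := by
      have := h.smooth_m.continuousAt hn
      have h' : ContinuousAt (fun y => Real.exp (-m y)) n := by fun_prop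
      exact h'.isBigO_one ℝ
    have hc' : (fun y : E3 => ‖y‖ ^ 2) =O[𝓝 n] fun _ => (1 : ℝ) :=
      (by fun_prop : ContinuousAt (fun y : E3 => ‖y‖ ^ 2) n).isBigO_one ℝ
    simpa using hc.mul (hc'.mul (hdu.norm_left.pow 2))
  have hu0 : Tendsto u (𝓝 n) (𝓝 0) := by
    refine hu.trans_tendsto ?_
    have : ContinuousAt (fun x : E3 => ‖x - n‖ ^ k) n := by fun_prop
    simpa [ContinuousAt, hk] using this
  have h2 : potential u =O[𝓝 n] fun x => (‖x - n‖ ^ k) ^ 2 := by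
    have hφ : (fun t : ℝ => 6 * (Real.cosh (1 / 2 * t) - 1)) =O[𝓝 0] fun t => ‖t - 0‖ ^ 2 := by
      refine isBigO_sub_sq ?_ (by simp) ?_
      · exact (contDiffAt_const.mul (((Real.contDiff_cosh).comp
          (contDiff_const.mul contDiff_id)).contDiffAt.sub contDiffAt_const))
      · have : HasDerivAt (fun t : ℝ => 6 * (Real.cosh (1 / 2 * t) - 1)) 0 0 := by
          refine ((((hasDerivAt_id (0 : ℝ)).const_mul (1 / 2 : ℝ)).cosh.sub_const 1).const_mul
            6).congr_deriv ?_
          simp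
        rw [this.hasFDerivAt.fderiv]
        ext
        simp
    have := hφ.comp_tendsto hu0
    refine this.trans ?_
    simpa [Function.comp_def] using hu.pow 2
  exact (h1.const_mul_left (1 / 4)).add h2

theorem IsPair.energy_neg (h : IsPair u m) (y : E3) : energy u m (-y) = energy u m y := by
  have hf : ‖fderiv ℝ u (-y)‖ = ‖fderiv ℝ u y‖ := by
    have h2 := fderiv_comp_smul (𝕜 := ℝ) (f := u) (x := y) (-1)
    rw [show (fun x => u ((-1 : ℝ) • x)) = u from funext fun x => by simp [h.even_u]] at h2
    rw [h2]
    simp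
  rw [energy, energy, potential, potential, hf, h.even_u, h.even_m, norm_neg]

theorem gap_neg (p y : E3) : gap p (-y) = gap p y := by
  simp [gap]

theorem IsPair.energy_le_gap_pow (h : IsPair u m) {n : E3} (hn : ‖n‖ = 1) {k : ℕ}
    (hO : energy u m =O[𝓝 n] fun x => (‖x - n‖ ^ k) ^ 2) :
    ∃ C, 0 ≤ C ∧ ∀ x, ‖x‖ = 1 → energy u m x ≤ C * gap n x ^ k := by
  obtain ⟨C, hC⟩ := hO.bound
  obtain ⟨r, hr, hball⟩ := Metric.eventually_nhds_iff.mp hC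
  obtain ⟨M, hM⟩ : ∃ M, ∀ x : E3, ‖x‖ = 1 → energy u m x ≤ M := by
    have hcont : ContinuousOn (energy u m) (Metric.sphere (0 : E3) 1) := fun x hx =>
      (h.continuousAt_energy (ne_zero_of_norm_eq_one (by simpa using hx))).continuousWithinAt
    obtain ⟨M, hM⟩ := (isCompact_sphere (0 : E3) 1).bddAbove_image hcont
    exact ⟨M, fun x hx => hM ⟨x, by simpa using hx, rfl⟩⟩
  have hM0 : 0 ≤ M := (energy_nonneg u m n).trans (hM n hn)
  refine ⟨|C| * 2 ^ k + M * (2 / r ^ 2) ^ k, by positivity, ?_⟩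
  have key : ∀ x : E3, ‖x‖ = 1 → 0 ≤ ⟪x, n⟫_ℝ →
      energy u m x ≤ (|C| * 2 ^ k + M * (2 / r ^ 2) ^ k) * gap n x ^ k := fun x hx hxn => by
    have hle : ⟪x, n⟫_ℝ ≤ 1 := by simpa [hx, hn] using real_inner_le_norm x n
    have hsq : ‖x - n‖ ^ 2 ≤ 2 * gap n x := by
      rw [@norm_sub_sq ℝ, gap_of_norm_eq_one n hx, hx, hn]
      simp only [RCLike.re_to_real]
      nlinarith
    have hg := gap_nonneg hn x
    rw [add_mul, mul_assoc, mul_assoc, ← mul_pow, ← mul_pow]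
    rcases lt_or_ge ‖x - n‖ r with hlt | hge
    · have := hball (y := x) (by rwa [dist_eq_norm])
      rw [Real.norm_of_nonneg (energy_nonneg u m x), Real.norm_of_nonneg (by positivity),
        ← pow_mul, mul_comm k, pow_mul] at this
      have h2 : 0 ≤ M * (2 / r ^ 2 * gap n x) ^ k := by positivity
      have h3 : C * (‖x - n‖ ^ 2) ^ k ≤ |C| * (2 * gap n x) ^ k := by
        gcongr
        exact le_abs_self C
      linarith
    · have h1 : 1 ≤ 2 / r ^ 2 * gap n x := by
        have : r ^ 2 ≤ ‖x - n‖ ^ 2 := by gcongr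
        rw [div_mul_eq_mul_div, le_div_iff₀ (by positivity)]
        linarith
      have h2 : 1 ≤ (2 / r ^ 2 * gap n x) ^ k := one_le_pow₀ h1
      have h3 : 0 ≤ |C| * (2 * gap n x) ^ k := by positivity
      nlinarith [hM x hx]
  intro x hx
  rcases le_total 0 ⟪x, n⟫_ℝ with h0 | h0
  · exact key x hx h0
  · rw [← h.energy_neg, ← gap_neg]
    exact key (-x) (by simpa using hx) (by simpa using h0)

/-- A pair vanishing to first order at two non-antipodal points is trivial. -/
theorem IsPair.eq_zero_of_two_nodes (h : IsPair u m) {n n' : E3} (hn : ‖n‖ = 1) (hn' : ‖n'‖ = 1)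
    (hne : n ≠ n') (hne' : n ≠ -n') (h0 : u n = 0) (h1 : fderiv ℝ u n = 0) (h0' : u n' = 0)
    (h1' : fderiv ℝ u n' = 0) {x : E3} (hx : ‖x‖ = 1) : u x = 0 := by
  have node : ∀ n : E3, ‖n‖ = 1 → u n = 0 → fderiv ℝ u n = 0 →
      ∃ C, 0 ≤ C ∧ ∀ x, ‖x‖ = 1 → energy u m x ≤ C * gap n x := fun n hn h0 h1 => by
    have hn0 := ne_zero_of_norm_eq_one hn
    have hA := (h.smooth_u.hasFDerivAt hn0).isBigO_sub
    have hB := (((h.smooth_u n hn0).fderiv_right (m := 1) (by norm_cast)).differentiableAt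
      (by norm_num)).hasFDerivAt.isBigO_sub
    simp only [h0, h1, sub_zero] at hA hB
    simpa using h.energy_le_gap_pow hn (k := 1) (h.energy_isBigO hn0 one_ne_zero
      (by simpa using hA.norm_right) (by simpa using hB.norm_right))
  obtain ⟨C, hC0, hC⟩ := node n hn h0 h1
  obtain ⟨C', hC0', hC'⟩ := node n' hn' h0' h1'
  obtain ⟨s, hs, hsum⟩ : ∃ s, 0 < s ∧ ∀ x : E3, ‖x‖ = 1 → s ≤ gap n x + gap n' x := by
    obtain ⟨z, hz, hmin⟩ := (isCompact_sphere (0 : E3) 1).exists_isMinOn ⟨n, by simpa using hn⟩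
      ((continuous_gap n).add (continuous_gap n')).continuousOn
    have hz1 : ‖z‖ = 1 := by simpa using hz
    refine ⟨gap n z + gap n' z, ?_, fun x hx => hmin (by simpa using hx)⟩
    refine lt_of_le_of_ne (add_nonneg (gap_nonneg hn z) (gap_nonneg hn' z)) fun heq => ?_
    have ha : gap n z = 0 := by linarith [gap_nonneg hn z, gap_nonneg hn' z]
    have hb : gap n' z = 0 := by linarith [gap_nonneg hn z, gap_nonneg hn' z]
    have par : ∀ p : E3, ‖p‖ = 1 → gap p z = 0 → p = z ∨ p = -z := fun p hp hg => by
      rw [gap_of_norm_eq_one p hz1] at hg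
      have : (⟪z, p⟫_ℝ - 1) * (⟪z, p⟫_ℝ + 1) = 0 := by linear_combination -hg
      rcases mul_eq_zero.mp this with h | h
      · left
        exact ((inner_eq_one_iff_of_norm_eq_one (𝕜 := ℝ) hz1 hp).mp (by linarith)).symm
      · right
        have : ⟪-z, p⟫_ℝ = 1 := by rw [inner_neg_left]; linarith
        exact ((inner_eq_one_iff_of_norm_eq_one (𝕜 := ℝ) (by simpa using hz1) hp).mp this).symm
    rcases par n hn ha with e | e <;> rcases par n' hn' hb with e' | e' <;> simp_all
  have hcap : ∀ x : E3, ‖x‖ = 1 → ∀ a b : E3, s ≤ gap a x + gap b x →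
      max (2 / 3) (1 - s / 4) ≤ ⟪x, a⟫_ℝ ^ 2 → ⟪x, b⟫_ℝ ^ 2 ≤ max (2 / 3) (1 - s / 4) :=
    fun x hx a b hab ha => by
      rw [gap_of_norm_eq_one a hx, gap_of_norm_eq_one b hx] at hab
      have h2 := (le_max_right (2 / 3) (1 - s / 4)).trans ha
      refine le_trans ?_ (le_max_right _ _)
      linarith
  refine h.eq_zero_of_energy_le hn hn' (c := max (2 / 3) (1 - s / 4))
    (C := 2 * (C + C') / s) (le_max_left _ _) (max_lt (by norm_num) (by linarith))
    (fun x hx hx' => Or.inl (hcap x hx n n' (hsum x hx) hx'))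
    (fun x hx hx' => Or.inl (hcap x hx n' n (by linarith [hsum x hx]) hx')) (fun x hx => ?_) hx
  have ha := gap_nonneg hn x
  have hb := gap_nonneg hn' x
  have hE := hC x hx
  have hE' := hC' x hx
  have hS := hsum x hx
  rw [div_mul_eq_mul_div, le_div_iff₀ hs]
  rcases le_total (gap n x) (gap n' x) with hab | hab
  · have h1 : energy u m x * s ≤ (C * gap n x) * (2 * gap n' x) := by
      gcongr; linarith
    nlinarith [mul_nonneg hC0' (mul_nonneg ha hb)]
  · have h1 : energy u m x * s ≤ (C' * gap n' x) * (2 * gap n x) := by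
      gcongr; linarith
    nlinarith [mul_nonneg hC0 (mul_nonneg ha hb)]

/-- A pair vanishing to second order at a point is trivial. -/
theorem IsPair.eq_zero_of_double_node (h : IsPair u m) {n : E3} (hn : ‖n‖ = 1) (h0 : u n = 0)
    (h1 : fderiv ℝ u n = 0) (h2 : ∀ v w, dirDeriv v (dirDeriv w u) n = 0) {x : E3}
    (hx : ‖x‖ = 1) : u x = 0 := by
  have hn0 := ne_zero_of_norm_eq_one hn
  have hc : ContDiffAt ℝ 2 (fderiv ℝ u) n :=
    (h.smooth_u n hn0).fderiv_right (m := 2) (by norm_cast)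
  have hd : fderiv ℝ (fderiv ℝ u) n = 0 := by
    ext v w
    have := h2 v w
    unfold dirDeriv at this
    rw [fderiv_clm_apply (hc.differentiableAt (by norm_num)) (by fun_prop)] at this
    simpa using this
  obtain ⟨C, -, hC⟩ := h.energy_le_gap_pow hn (k := 2) (h.energy_isBigO hn0 two_ne_zero
    (isBigO_sub_sq ((h.smooth_u n hn0).of_le (by norm_cast)) h0 h1) (isBigO_sub_sq hc h1 hd))
  exact h.eq_zero_of_energy_le hn hn (c := 2 / 3) le_rfl (by norm_num)
    (fun _ _ _ => Or.inr rfl) (fun _ _ _ => Or.inr rfl)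
    (fun x hx => by rw [← sq]; exact hC x hx) hx

end MeanField

namespace MeanField

open Filter Topology ContDiff InnerProductSpace Laplacian

variable {W : E3 → ℝ}

theorem dirDeriv_add_left (v w : E3) (f : E3 → ℝ) (y : E3) :
    dirDeriv (v + w) f y = dirDeriv v f y + dirDeriv w f y := map_add _ _ _

theorem dirDeriv_sub_left (v w : E3) (f : E3 → ℝ) (y : E3) :
    dirDeriv (v - w) f y = dirDeriv v f y - dirDeriv w f y := map_sub _ _ _

theorem dirDeriv_smul_left (c : ℝ) (v : E3) (f : E3 → ℝ) (y : E3) :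
    dirDeriv (c • v) f y = c * dirDeriv v f y := map_smul _ _ _

theorem dirDeriv_neg_left (v : E3) (f : E3 → ℝ) (y : E3) :
    dirDeriv (-v) f y = -dirDeriv v f y := map_neg _ _

theorem SmoothOff.dirDeriv_dirDeriv_eq (hW : SmoothOff W) {y : E3} (hy : y ≠ 0) (v w : E3) :
    MeanField.dirDeriv v (MeanField.dirDeriv w W) y = fderiv ℝ (fderiv ℝ W) y v w := by
  have hd : DifferentiableAt ℝ (fderiv ℝ W) y :=
    ((hW y hy).fderiv_right (m := 1) (by norm_cast)).differentiableAt (by norm_num)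
  rw [MeanField.dirDeriv, show MeanField.dirDeriv w W = fun z => fderiv ℝ W z w from rfl,
    fderiv_clm_apply hd (by fun_prop)]
  simp

/-- Reflection in the plane orthogonal to `μ`. -/
noncomputable def mirror (μ : E3) : E3 ≃ₗᵢ[ℝ] E3 := (ℝ ∙ μ)ᗮ.reflection

theorem mirror_apply {μ : E3} (hμ : ‖μ‖ = 1) (y : E3) : mirror μ y = y - (2 * ⟪μ, y⟫_ℝ) • μ := by
  rw [mirror, Submodule.reflection_orthogonal_apply, Submodule.reflection_singleton_apply, hμ]
  simp [two_smul, add_smul, two_mul]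

theorem mirror_self (μ : E3) : mirror μ μ = -μ :=
  Submodule.reflection_orthogonalComplement_singleton_eq_neg μ

theorem mirror_of_inner_eq_zero {μ y : E3} (hμ : ‖μ‖ = 1) (h : ⟪μ, y⟫_ℝ = 0) :
    mirror μ y = y := by
  rw [mirror_apply hμ, h]; simp

/-- Invariance under the reflection in the plane orthogonal to `μ`. -/
def MirrorSymm (W : E3 → ℝ) (μ : E3) : Prop := ∀ y, W (mirror μ y) = W y

theorem MirrorSymm.dirDeriv_mirror {μ : E3} (hs : MirrorSymm W μ) (hW : SmoothOff W) (v : E3)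
    {y : E3} (hy : y ≠ 0) : dirDeriv (mirror μ v) W (mirror μ y) = dirDeriv v W y := by
  rw [← dirDeriv_comp_isometry hW (mirror μ) v hy,
    show (fun y => W (mirror μ y)) = W from funext hs]

theorem MirrorSymm.dirDeriv_eq_zero {μ : E3} (hs : MirrorSymm W μ) (hW : SmoothOff W)
    (hμ : ‖μ‖ = 1) {y : E3} (hy : y ≠ 0) (h : ⟪μ, y⟫_ℝ = 0) : dirDeriv μ W y = 0 := by
  have := hs.dirDeriv_mirror hW μ hy
  rw [mirror_self, mirror_of_inner_eq_zero hμ h, dirDeriv_neg_left] at this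
  linarith

theorem MirrorSymm.hess_eq_zero {μ : E3} (hs : MirrorSymm W μ) (hW : SmoothOff W)
    (hμ : ‖μ‖ = 1) {y v : E3} (hy : y ≠ 0) (h : ⟪μ, y⟫_ℝ = 0) (hv : ⟪μ, v⟫_ℝ = 0) :
    fderiv ℝ (fderiv ℝ W) y μ v = 0 := by
  have := dirDeriv_dirDeriv_comp_isometry hW (mirror μ) μ v hy
  rw [show (fun y => W (mirror μ y)) = W from funext hs, mirror_self,
    mirror_of_inner_eq_zero hμ h, mirror_of_inner_eq_zero hμ hv, dirDeriv_neg_left,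
    hW.dirDeriv_dirDeriv_eq hy] at this
  linarith

theorem IsSol.dirDeriv_neg (hW : IsSol W) (v : E3) {y : E3} (hy : y ≠ 0) :
    dirDeriv v W (-y) = -dirDeriv v W y := by
  have := dirDeriv_comp_isometry hW.smooth (LinearIsometryEquiv.neg ℝ) v hy
  rw [show (fun y => W (LinearIsometryEquiv.neg ℝ y)) = W from funext hW.even] at this
  rw [this, LinearIsometryEquiv.coe_neg, dirDeriv_neg_left, neg_neg]

/-- The pole of a reflection symmetry is a critical point. -/
theorem IsSol.dirDeriv_pole (hW : IsSol W) {μ : E3} (hμ : ‖μ‖ = 1) (hs : MirrorSymm W μ) (v : E3) :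
    dirDeriv v W μ = 0 := by
  have hμ0 := ne_zero_of_norm_eq_one hμ
  have := hs.dirDeriv_mirror hW.smooth v hμ0
  rw [mirror_self, hW.dirDeriv_neg _ hμ0, mirror_apply hμ, dirDeriv_sub_left, dirDeriv_smul_left,
    hW.homog.dirDeriv_self hW.smooth hμ0] at this
  linarith

theorem HomogZero.eq_of_sphere {F : E3 → ℝ} (hF : HomogZero F) {y : E3} (hy : y ≠ 0) :
    F (‖y‖⁻¹ • y) = F y := hF _ (by positivity) y

theorem mirrorSymm_of_sphere (hW : IsSol W) {μ : E3}
    (h : ∀ x : E3, ‖x‖ = 1 → W (mirror μ x) - W x = 0) : MirrorSymm W μ := fun y => by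
  rcases eq_or_ne y 0 with rfl | hy
  · rw [map_zero]
  · have := h _ (norm_inv_norm_smul hy)
    rw [map_smul, hW.homog _ (by positivity), hW.homog _ (by positivity)] at this
    linarith

theorem fderiv_reflected_sub (hW : IsSol W) {μ n : E3} (hμ : ‖μ‖ = 1) (hn : ‖n‖ = 1)
    (hμn : ⟪μ, n⟫_ℝ = 0) (hd : dirDeriv μ W n = 0) :
    fderiv ℝ (fun y => W (mirror μ y) - W y) n = 0 := by
  have hn0 := ne_zero_of_norm_eq_one hn
  ext v
  have h1 := (hW.smooth.comp_isometry (mirror μ)).hasFDerivAt hn0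
  rw [(h1.fun_sub (hW.smooth.hasFDerivAt hn0)).fderiv]
  have h2 := dirDeriv_comp_isometry hW.smooth (mirror μ) v hn0
  rw [mirror_of_inner_eq_zero hμ hμn, mirror_apply hμ, dirDeriv_sub_left, dirDeriv_smul_left,
    hd] at h2
  simp only [dirDeriv] at h2
  simp [h2]

/-- If the normal derivative of a solution along the plane orthogonal to `μ` vanishes at two
non-antipodal points of the plane, then the solution is symmetric with respect to that plane. -/
theorem IsSol.mirrorSymm_of_two_points (hW : IsSol W) {μ n n' : E3} (hμ : ‖μ‖ = 1) (hn : ‖n‖ = 1)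
    (hn' : ‖n'‖ = 1) (hne : n ≠ n') (hne' : n ≠ -n') (hμn : ⟪μ, n⟫_ℝ = 0) (hμn' : ⟪μ, n'⟫_ℝ = 0)
    (hd : dirDeriv μ W n = 0) (hd' : dirDeriv μ W n' = 0) : MirrorSymm W μ := by
  refine mirrorSymm_of_sphere hW fun x hx => ?_
  refine ((hW.comp_isometry (mirror μ)).isPair hW).eq_zero_of_two_nodes hn hn' hne hne' ?_
    (fderiv_reflected_sub hW hμ hn hμn hd) ?_ (fderiv_reflected_sub hW hμ hn' hμn' hd') hx
  · simp [mirror_of_inner_eq_zero hμ hμn]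
  · simp [mirror_of_inner_eq_zero hμ hμn']

theorem basis_repr (b : OrthonormalBasis (Fin 3) ℝ E3) (y : E3) :
    y = ⟪b 0, y⟫_ℝ • b 0 + ⟪b 1, y⟫_ℝ • b 1 + ⟪b 2, y⟫_ℝ • b 2 := by
  simpa [Fin.sum_univ_three] using (b.sum_repr' y).symm

/-- Two oblique reflection symmetries through an axis force rotational symmetry about it. -/
theorem IsSol.axial (hW : IsSol W) (b : OrthonormalBasis (Fin 3) ℝ E3) {α β : ℝ} (hα : α ≠ 0)
    (hβ : β ≠ 0) (hcrit : ∀ v, dirDeriv v W (b 2) = 0) (hs : MirrorSymm W (b 0))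
    (hν : ‖α • b 0 + β • b 1‖ = 1) (hs' : MirrorSymm W (α • b 0 + β • b 1)) {μ : E3}
    (hμ : ‖μ‖ = 1) (hμ2 : ⟪b 2, μ⟫_ℝ = 0) : MirrorSymm W μ := by
  have hp0 : b 2 ≠ 0 := b.orthonormal.ne_zero 2
  have hin := fun i j => orthonormal_iff_ite.mp b.orthonormal i j
  have h01 : fderiv ℝ (fderiv ℝ W) (b 2) (b 0) (b 1) = 0 :=
    hs.hess_eq_zero hW.smooth (by simp) hp0 (by simp [hin]) (by simp [hin])
  have hsymm : ∀ v w, fderiv ℝ (fderiv ℝ W) (b 2) v w = fderiv ℝ (fderiv ℝ W) (b 2) w v :=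
    fun v w => by
      rw [← hW.smooth.dirDeriv_dirDeriv_eq hp0, ← hW.smooth.dirDeriv_dirDeriv_eq hp0,
        hW.smooth.dirDeriv_comm hp0]
  have h2 : ∀ v, fderiv ℝ (fderiv ℝ W) (b 2) (b 2) v = 0 := fun v => by
    rw [← hW.smooth.dirDeriv_dirDeriv_eq hp0, hW.homog.dirDeriv_dirDeriv_self hW.smooth hp0,
      hcrit, neg_zero]
  have h10 := (hsymm (b 1) (b 0)).trans h01
  have hdiag : fderiv ℝ (fderiv ℝ W) (b 2) (b 1) (b 1) =
      fderiv ℝ (fderiv ℝ W) (b 2) (b 0) (b 0) := by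
    have := hs'.hess_eq_zero hW.smooth hν (v := (-β) • b 0 + α • b 1) hp0
      (by simp [inner_add_left, inner_smul_left, hin])
      (by simp [inner_add_left, inner_add_right, inner_smul_left, inner_smul_right, hin]; ring)
    simp only [map_add, map_smul, add_apply, smul_apply,
      h01, h10, smul_eq_mul] at this
    refine mul_left_cancel₀ (mul_ne_zero hα hβ) ?_
    linear_combination this
  have hform : ∀ v w, fderiv ℝ (fderiv ℝ W) (b 2) v w =
      fderiv ℝ (fderiv ℝ W) (b 2) (b 0) (b 0) * (⟪v, w⟫_ℝ - ⟪b 2, v⟫_ℝ * ⟪b 2, w⟫_ℝ) :=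
    fun v w => by
      conv_lhs => rw [basis_repr b v, basis_repr b w]
      rw [← sum_inner_mul_inner b v w, real_inner_comm (b 0) v, real_inner_comm (b 1) v,
        real_inner_comm (b 2) v]
      simp only [map_add, map_smul, add_apply, smul_apply,
        h01, h10, hdiag, h2, hsymm _ (b 2), smul_eq_mul]
      ring
  have hμb : ⟪μ, b 2⟫_ℝ = 0 := by rw [real_inner_comm]; exact hμ2
  have hmir : ∀ v, ⟪b 2, mirror μ v⟫_ℝ = ⟪b 2, v⟫_ℝ := fun v => by
    rw [mirror_apply hμ, inner_sub_right, inner_smul_right, hμ2]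
    ring
  refine mirrorSymm_of_sphere hW fun x hx => ?_
  have hpair := (hW.comp_isometry (mirror μ)).isPair hW
  refine hpair.eq_zero_of_double_node (n := b 2) (by simp) ?_
    (fderiv_reflected_sub hW hμ (by simp) hμb (hcrit μ)) (fun v w => ?_) hx
  · simp [mirror_of_inner_eq_zero hμ hμb]
  · have h1 : dirDeriv w (fun y => W (mirror μ y) - W y) =ᶠ[𝓝 (b 2)]
        fun y => dirDeriv w (fun y => W (mirror μ y)) y - dirDeriv w W y := by
      filter_upwards [eventually_ne_nhds hp0] with z hz
      have h1 := (hW.smooth.comp_isometry (mirror μ)).hasFDerivAt hz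
      rw [dirDeriv, (h1.fun_sub (hW.smooth.hasFDerivAt hz)).fderiv]
      simp [dirDeriv]
    rw [dirDeriv_congr h1 v]
    have h3 := ((hW.smooth.comp_isometry (mirror μ)).dirDeriv w).hasFDerivAt hp0
    rw [dirDeriv, (h3.fun_sub ((hW.smooth.dirDeriv w).hasFDerivAt hp0)).fderiv]
    have h4 := dirDeriv_dirDeriv_comp_isometry hW.smooth (mirror μ) v w hp0
    rw [mirror_of_inner_eq_zero hμ hμb, hW.smooth.dirDeriv_dirDeriv_eq hp0, hform,
      LinearIsometryEquiv.inner_map_map, hmir, hmir, ← hform,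
      ← hW.smooth.dirDeriv_dirDeriv_eq hp0] at h4
    simp only [dirDeriv] at h4
    simp [h4]

end MeanField

namespace MeanField

open Filter Topology ContDiff InnerProductSpace Laplacian

variable {W : E3 → ℝ}

/-- The derivative of `W` along the rotation in the plane of `b i` and `b j`. -/
noncomputable def angular (W : E3 → ℝ) (b : OrthonormalBasis (Fin 3) ℝ E3) (i j : Fin 3) (y : E3) :
    ℝ :=
  ⟪b i, y⟫_ℝ * dirDeriv (b j) W y - ⟪b j, y⟫_ℝ * dirDeriv (b i) W y

theorem angular_eq_zero_of_apply_eq_zero (hW : IsSol W) (b : OrthonormalBasis (Fin 3) ℝ E3)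
    (hs : ∀ i, MirrorSymm W (b i)) {n : E3} (hn : ‖n‖ = 1) (hcoord : ∀ i, ⟪b i, n⟫_ℝ ≠ 0)
    (h : angular W b 0 1 n = 0) {y : E3} (hy : y ≠ 0) : angular W b 0 1 y = 0 := by
  have hn0 := ne_zero_of_norm_eq_one hn
  have hin := fun i j => orthonormal_iff_ite.mp b.orthonormal i j
  -- the unit vector of the rotation in the plane of `b 0` and `b 1`
  have hrot : ∀ z : E3, (-⟪b 1, z⟫_ℝ) • b 0 + ⟪b 0, z⟫_ℝ • b 1 ≠ 0 →
      ∃ s : ℝ, s ≠ 0 ∧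
        ‖(s * -⟪b 1, z⟫_ℝ) • b 0 + (s * ⟪b 0, z⟫_ℝ) • b 1‖ = 1 ∧
        ⟪b 2, (s * -⟪b 1, z⟫_ℝ) • b 0 + (s * ⟪b 0, z⟫_ℝ) • b 1⟫_ℝ = 0 ∧
        ⟪(s * -⟪b 1, z⟫_ℝ) • b 0 + (s * ⟪b 0, z⟫_ℝ) • b 1, z⟫_ℝ = 0 ∧
        dirDeriv ((s * -⟪b 1, z⟫_ℝ) • b 0 + (s * ⟪b 0, z⟫_ℝ) • b 1) W z =
          s * angular W b 0 1 z := fun z hz => by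
    refine ⟨‖(-⟪b 1, z⟫_ℝ) • b 0 + ⟪b 0, z⟫_ℝ • b 1‖⁻¹, inv_ne_zero (norm_ne_zero_iff.mpr hz),
      ?_, ?_, ?_, ?_⟩
    · rw [mul_smul, mul_smul, ← smul_add]
      exact norm_inv_norm_smul hz
    · simp [inner_add_right, inner_smul_right, hin]
    · simp only [inner_add_left, inner_smul_left, conj_trivial]
      ring
    · rw [dirDeriv_add_left, dirDeriv_smul_left, dirDeriv_smul_left, angular]
      ring
  have hne : (-⟪b 1, n⟫_ℝ) • b 0 + ⟪b 0, n⟫_ℝ • b 1 ≠ 0 := fun h0 => by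
    have := congrArg (fun v => ⟪b 1, v⟫_ℝ) h0
    simp [inner_add_right, inner_smul_right, hin] at this
    exact hcoord 0 this
  obtain ⟨s, hs0, hν, hν2, hνn, hνd⟩ := hrot n hne
  rw [h, mul_zero] at hνd
  have hfix := mirror_of_inner_eq_zero (by simp) hν2
  have hn' : mirror (b 2) n = n - (2 * ⟪b 2, n⟫_ℝ) • b 2 := mirror_apply (by simp) n
  have hsν : MirrorSymm W ((s * -⟪b 1, n⟫_ℝ) • b 0 + (s * ⟪b 0, n⟫_ℝ) • b 1) := by
    refine hW.mirrorSymm_of_two_points hν hn (n' := mirror (b 2) n)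
      (by rw [LinearIsometryEquiv.norm_map, hn]) ?_ ?_ hνn ?_ hνd ?_
    · intro heq
      have := congrArg (fun v => ⟪b 2, v⟫_ℝ) heq
      simp only [hn', inner_sub_right, inner_smul_right, hin, if_true, mul_one] at this
      exact hcoord 2 (by linarith)
    · intro heq
      have := congrArg (fun v => ⟪b 0, v⟫_ℝ) heq
      simp [hn', inner_sub_right, inner_smul_right, hin] at this
      exact hcoord 0 (by linarith)
    · rw [← hfix, LinearIsometryEquiv.inner_map_map, hνn]
    · rw [← hfix, (hs 2).dirDeriv_mirror hW.smooth _ hn0, hνd]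
  by_cases hz : (-⟪b 1, y⟫_ℝ) • b 0 + ⟪b 0, y⟫_ℝ • b 1 = 0
  · have h0 := congrArg (fun v => ⟪b 0, v⟫_ℝ) hz
    have h1 := congrArg (fun v => ⟪b 1, v⟫_ℝ) hz
    simp [inner_add_right, inner_smul_right, hin] at h0 h1
    simp [angular, h0, h1]
  · obtain ⟨t, ht, hτ, hτ2, hτy, hτd⟩ := hrot y hz
    have hsym := hW.axial b (mul_ne_zero hs0 (neg_ne_zero.mpr (hcoord 1)))
      (mul_ne_zero hs0 (hcoord 0)) (hW.dirDeriv_pole (by simp) (hs 2)) (hs 0) hν hsν hτ hτ2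
    rw [hsym.dirDeriv_eq_zero hW.smooth hτ hy hτy] at hτd
    exact (mul_eq_zero.mp hτd.symm).resolve_left ht

theorem HomogZero.fderiv_eq_zero_of_max {F : E3 → ℝ} (hF : HomogZero F) {p : E3} (hp : ‖p‖ = 1)
    (hmax : ∀ x : E3, ‖x‖ = 1 → F x ≤ F p) : fderiv ℝ F p = 0 :=
  (isLocalMax_of_sphere hp ((eventually_ne_nhds (ne_zero_of_norm_eq_one hp)).mono
    fun _ hy => hF.eq_of_sphere hy) (Eventually.of_forall hmax)).fderiv_eq_zero

/-- A solution which is not constant on the sphere is symmetric with respect to three mutually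
orthogonal planes. -/
theorem IsSol.exists_frame (hW : IsSol W) {x₁ x₂ : E3} (hx₁ : ‖x₁‖ = 1) (hx₂ : ‖x₂‖ = 1)
    (hne : W x₁ ≠ W x₂) :
    ∃ b : OrthonormalBasis (Fin 3) ℝ E3, ∀ i, MirrorSymm W (b i) := by
  have hcont : ContinuousOn W (Metric.sphere (0 : E3) 1) :=
    hW.smooth.continuousOn fun y hy => ne_zero_of_norm_eq_one (by simpa using hy)
  obtain ⟨p, hp, hmax⟩ :=
    (isCompact_sphere (0 : E3) 1).exists_isMaxOn ⟨x₁, by simpa using hx₁⟩ hcont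
  obtain ⟨q, hq, hmin⟩ :=
    (isCompact_sphere (0 : E3) 1).exists_isMinOn ⟨x₁, by simpa using hx₁⟩ hcont
  have hmax : ∀ x : E3, ‖x‖ = 1 → W x ≤ W p := fun x hx => hmax (by simpa using hx)
  have hmin : ∀ x : E3, ‖x‖ = 1 → W q ≤ W x := fun x hx => hmin (by simpa using hx)
  have hp : ‖p‖ = 1 := by simpa using hp
  have hq : ‖q‖ = 1 := by simpa using hq
  have hlt : W q ≠ W p := fun heq => hne (by
    linarith [hmax x₁ hx₁, hmax x₂ hx₂, hmin x₁ hx₁, hmin x₂ hx₂])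
  have hqp : q ≠ p := fun h => hlt (by rw [h])
  have hqp' : q ≠ -p := fun h => hlt (by rw [h, hW.even])
  have hcp : ∀ v, dirDeriv v W p = 0 := fun v => by
    rw [dirDeriv, hW.homog.fderiv_eq_zero_of_max hp hmax]; rfl
  have hcq : ∀ v, dirDeriv v W q = 0 := fun v => by
    have hneg : HomogZero (fun y => -W y) := fun c hc y => by simp only [hW.homog c hc y]
    have := hneg.fderiv_eq_zero_of_max hq (fun x hx => neg_le_neg (hmin x hx))
    rw [fderiv_fun_neg, neg_eq_zero] at this
    rw [dirDeriv, this]; rfl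
  have hq'0 : q - ⟪p, q⟫_ℝ • p ≠ 0 := fun h0 => by
    have hq' : q = ⟪p, q⟫_ℝ • p := sub_eq_zero.mp h0
    have hab : |⟪p, q⟫_ℝ| = 1 := by
      have := congrArg norm hq'
      rw [norm_smul, hp, hq, mul_one] at this
      exact this.symm
    rcases eq_or_eq_neg_of_abs_eq hab with h | h <;> rw [h] at hq'
    · exact hqp (by simpa using hq')
    · exact hqp' (by simpa using hq')
  obtain ⟨b, hb0, hb2⟩ : ∃ b : OrthonormalBasis (Fin 3) ℝ E3,
      b 0 = ‖q - ⟪p, q⟫_ℝ • p‖⁻¹ • (q - ⟪p, q⟫_ℝ • p) ∧ b 2 = p := by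
    have hv : Orthonormal ℝ (({0, 2} : Set (Fin 3)).domRestrict
        ![‖q - ⟪p, q⟫_ℝ • p‖⁻¹ • (q - ⟪p, q⟫_ℝ • p), 0, p]) := by
      have hpe : ⟪p, ‖q - ⟪p, q⟫_ℝ • p‖⁻¹ • (q - ⟪p, q⟫_ℝ • p)⟫_ℝ = 0 := by
        rw [inner_smul_right, inner_sub_right, inner_smul_right, real_inner_self_eq_norm_sq, hp]
        ring
      constructor
      · rintro ⟨i, rfl | rfl⟩
        · exact norm_inv_norm_smul hq'0
        · exact hp
      · rintro ⟨i, rfl | rfl⟩ ⟨j, rfl | rfl⟩ hij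
        · exact (hij rfl).elim
        · change ⟪_, p⟫_ℝ = 0
          rw [real_inner_comm]
          exact hpe
        · exact hpe
        · exact (hij rfl).elim
    obtain ⟨b, hb⟩ := hv.exists_orthonormalBasis_extension_of_card_eq (by simp)
    exact ⟨b, hb 0 (by simp), hb 2 (by simp)⟩
  have hin := fun i j => orthonormal_iff_ite.mp b.orthonormal i j
  have hdist : ∀ i j, i ≠ j → b i ≠ b j ∧ b i ≠ -b j := fun i j hij => by
    have hbi : ⟪b i, b i⟫_ℝ = 1 := by simp
    have hbj : ⟪b i, b j⟫_ℝ = 0 := by simp [hin, hij]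
    constructor <;> intro h
    · rw [← h] at hbj
      linarith
    · have : ⟪b i, b i⟫_ℝ = ⟪b i, -b j⟫_ℝ := congrArg _ h
      rw [inner_neg_right] at this
      linarith
  have h1p : ⟪b 1, p⟫_ℝ = 0 := by rw [← hb2]; simp [hin]
  have h1q : ⟪b 1, q⟫_ℝ = 0 := by
    have h10 : ⟪b 1, b 0⟫_ℝ = 0 := by simp [hin]
    rw [hb0, inner_smul_right, inner_sub_right, inner_smul_right, h1p, mul_zero, sub_zero] at h10
    exact (mul_eq_zero.mp h10).resolve_left (inv_ne_zero (norm_ne_zero_iff.mpr hq'0))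
  have hs1 : MirrorSymm W (b 1) :=
    hW.mirrorSymm_of_two_points (by simp) hq hp hqp hqp' h1q h1p (hcq _) (hcp _)
  have hs0 : MirrorSymm W (b 0) :=
    hW.mirrorSymm_of_two_points (n := b 1) (n' := b 2) (by simp) (by simp) (by simp)
      (hdist 1 2 (by decide)).1 (hdist 1 2 (by decide)).2 (by simp [hin]) (by simp [hin])
      (hW.dirDeriv_pole (by simp) hs1 _) (by rw [hb2]; exact hcp _)
  have hs2 : MirrorSymm W (b 2) :=
    hW.mirrorSymm_of_two_points (n := b 0) (n' := b 1) (by simp) (by simp) (by simp)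
      (hdist 0 1 (by decide)).1 (hdist 0 1 (by decide)).2 (by simp [hin]) (by simp [hin])
      (hW.dirDeriv_pole (by simp) hs0 _) (hW.dirDeriv_pole (by simp) hs1 _)
  exact ⟨b, fun i => by fin_cases i <;> assumption⟩

end MeanField

namespace MeanField

open Filter Topology ContDiff InnerProductSpace Laplacian MeasureTheory

variable {W : E3 → ℝ} (b : OrthonormalBasis (Fin 3) ℝ E3) (r t : ℝ)

theorem SmoothOff.hasDerivAt_dirDeriv {f : E3 → ℝ} (hf : SmoothOff f) {γ η : ℝ → E3} {γ' η' : E3}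
    {s : ℝ} (hγ : HasDerivAt γ γ' s) (hη : HasDerivAt η η' s) (h0 : γ s ≠ 0) :
    HasDerivAt (fun s => MeanField.dirDeriv (η s) f (γ s))
      (fderiv ℝ (fderiv ℝ f) (γ s) γ' (η s) + MeanField.dirDeriv η' f (γ s)) s := by
  have hd : DifferentiableAt ℝ (fderiv ℝ f) (γ s) :=
    ((hf _ h0).fderiv_right (m := 1) (by norm_cast)).differentiableAt (by norm_num)
  exact (hd.hasFDerivAt.comp_hasDerivAt s hγ).clm_apply hη

/-- The point of the unit sphere with polar coordinates `r`, `t` around `b 2`. -/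
noncomputable def polarPt : E3 :=
  (Real.sin r * Real.cos t) • b 0 + (Real.sin r * Real.sin t) • b 1 + Real.cos r • b 2

/-- The unit tangent vector in the direction of the polar coordinate `r`. -/
noncomputable def polarR : E3 :=
  (Real.cos r * Real.cos t) • b 0 + (Real.cos r * Real.sin t) • b 1 - Real.sin r • b 2

/-- The unit tangent vector in the direction of the polar coordinate `t`. -/
noncomputable def polarT : E3 := (-Real.sin t) • b 0 + Real.cos t • b 1

theorem hasDerivAt_polarPt_r : HasDerivAt (fun r => polarPt b r t) (polarR b r t) r := by
  unfold polarPt polarR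
  refine (((((Real.hasDerivAt_sin r).mul_const _).smul_const (b 0)).add
    (((Real.hasDerivAt_sin r).mul_const _).smul_const (b 1))).add
    ((Real.hasDerivAt_cos r).smul_const (b 2))).congr_deriv ?_
  module

theorem hasDerivAt_polarPt_t :
    HasDerivAt (fun t => polarPt b r t) (Real.sin r • polarT b t) t := by
  unfold polarPt polarT
  refine (((((Real.hasDerivAt_cos t).const_mul _).smul_const (b 0)).add
    (((Real.hasDerivAt_sin t).const_mul _).smul_const (b 1))).add_const
    (Real.cos r • b 2)).congr_deriv ?_
  module

theorem hasDerivAt_polarR_r : HasDerivAt (fun r => polarR b r t) (-polarPt b r t) r := by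
  unfold polarPt polarR
  refine (((((Real.hasDerivAt_cos r).mul_const _).smul_const (b 0)).add
    (((Real.hasDerivAt_cos r).mul_const _).smul_const (b 1))).sub
    ((Real.hasDerivAt_sin r).smul_const (b 2))).congr_deriv ?_
  module

theorem hasDerivAt_polarR_t :
    HasDerivAt (fun t => polarR b r t) (Real.cos r • polarT b t) t := by
  unfold polarR polarT
  refine (((((Real.hasDerivAt_cos t).const_mul _).smul_const (b 0)).add
    (((Real.hasDerivAt_sin t).const_mul _).smul_const (b 1))).sub_const
    (Real.sin r • b 2)).congr_deriv ?_
  module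

theorem hasDerivAt_polarT : HasDerivAt (fun t => polarT b t)
    (-(Real.sin r • polarPt b r t + Real.cos r • polarR b r t)) t := by
  unfold polarPt polarR polarT
  refine (((Real.hasDerivAt_sin t).neg.smul_const (b 0)).add
    ((Real.hasDerivAt_cos t).smul_const (b 1))).congr_deriv ?_
  have h : Real.sin r ^ 2 + Real.cos r ^ 2 = 1 := Real.sin_sq_add_cos_sq r
  rw [show (-Real.cos t) • b 0 + (-Real.sin t) • b 1 =
    (Real.sin r ^ 2 + Real.cos r ^ 2) • ((-Real.cos t) • b 0 + (-Real.sin t) • b 1) by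
      rw [h, one_smul]]
  module

theorem orthonormal_polar : Orthonormal ℝ ![polarR b r t, polarT b t, polarPt b r t] := by
  have hin := fun i j => orthonormal_iff_ite.mp b.orthonormal i j
  have h := Real.sin_sq_add_cos_sq r
  have h' := Real.sin_sq_add_cos_sq t
  rw [orthonormal_iff_ite]
  intro i j
  fin_cases i <;> fin_cases j <;>
    simp [-inner_self_eq_norm_sq_to_K, polarR, polarT, polarPt, inner_add_left, inner_add_right, inner_sub_left,
      inner_sub_right, inner_smul_left, inner_smul_right, hin] <;>
    ring_nf
  · linear_combination Real.cos r ^ 2 * h' + h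
  · linear_combination Real.sin r * Real.cos r * h'
  · linear_combination h'
  · linear_combination Real.sin r * Real.cos r * h'
  · linear_combination Real.sin r ^ 2 * h' + h

theorem norm_polarPt : ‖polarPt b r t‖ = 1 := (orthonormal_polar b r t).norm_eq_one 2

theorem polarPt_ne_zero : polarPt b r t ≠ 0 := ne_zero_of_norm_eq_one (norm_polarPt b r t)

theorem IsSol.polar_pde (hW : IsSol W) :
    fderiv ℝ (fderiv ℝ W) (polarPt b r t) (polarR b r t) (polarR b r t) +
      fderiv ℝ (fderiv ℝ W) (polarPt b r t) (polarT b t) (polarT b t) =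
      6 - 6 * Real.exp (W (polarPt b r t)) := by
  have h0 := polarPt_ne_zero b r t
  obtain ⟨e, he⟩ : ∃ e : OrthonormalBasis (Fin 3) ℝ E3,
      ⇑e = ![polarR b r t, polarT b t, polarPt b r t] := by
    have hv := (orthonormal_polar b r t).comp (Subtype.val (p := fun i => i ∈ (Set.univ : Set (Fin 3))))
      Subtype.val_injective
    obtain ⟨e, he⟩ := hv.exists_orthonormalBasis_extension_of_card_eq (by simp)
    exact ⟨e, funext fun i => he i (Set.mem_univ i)⟩
  have hpde := hW.pde _ h0
  rw [norm_polarPt, laplacian_eq_sum hW.smooth h0 e, he, Fin.sum_univ_three] at hpde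
  have h2 : dirDeriv (polarPt b r t) (dirDeriv (polarPt b r t) W) (polarPt b r t) = 0 := by
    rw [hW.homog.dirDeriv_dirDeriv_self hW.smooth h0, hW.homog.dirDeriv_self hW.smooth h0, neg_zero]
  simp only [Matrix.cons_val_zero, Matrix.cons_val_one, Matrix.cons_val, h2] at hpde
  rw [hW.smooth.dirDeriv_dirDeriv_eq h0, hW.smooth.dirDeriv_dirDeriv_eq h0] at hpde
  linarith

/-- The primitive of `sin ^ 2 / 2` vanishing at `π / 2`. -/
noncomputable def polarWeight (r : ℝ) : ℝ := 1 / 4 * (r - Real.sin r * Real.cos r) - π / 8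

theorem hasDerivAt_polarWeight : HasDerivAt polarWeight (1 / 2 * Real.sin r ^ 2) r := by
  unfold polarWeight
  refine ((((hasDerivAt_id r).sub ((Real.hasDerivAt_sin r).mul
    (Real.hasDerivAt_cos r))).const_mul (1 / 4 : ℝ)).sub_const (π / 8)).congr_deriv ?_
  linear_combination (1 / 4 : ℝ) * (-Real.sin_sq_add_cos_sq r)

/-- The radial component of the vector field in the Pohozaev-type identity. -/
noncomputable def fieldR (W : E3 → ℝ) (b : OrthonormalBasis (Fin 3) ℝ E3) (p : ℝ × ℝ) : ℝ :=
  Real.sin p.1 *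
    ((1 / 2 * (dirDeriv (polarR b p.1 p.2) W (polarPt b p.1 p.2) ^ 2 -
        dirDeriv (polarT b p.2) W (polarPt b p.1 p.2) ^ 2) +
        6 * (Real.exp (W (polarPt b p.1 p.2)) - 1 - W (polarPt b p.1 p.2))) *
        polarWeight p.1 * Real.cos (2 * p.2) +
      dirDeriv (polarR b p.1 p.2) W (polarPt b p.1 p.2) *
        dirDeriv (polarT b p.2) W (polarPt b p.1 p.2) *
        (1 / 2 * (1 / 2 * Real.sin p.1 ^ 3 - polarWeight p.1 * Real.cos p.1)) *
        Real.sin (2 * p.2) +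
      Real.sin p.1 ^ 2 * Real.cos (2 * p.2) * dirDeriv (polarR b p.1 p.2) W (polarPt b p.1 p.2) -
      W (polarPt b p.1 p.2) * (2 * Real.sin p.1 * Real.cos p.1 * Real.cos (2 * p.2)))

/-- The angular component of the vector field in the Pohozaev-type identity. -/
noncomputable def fieldT (W : E3 → ℝ) (b : OrthonormalBasis (Fin 3) ℝ E3) (p : ℝ × ℝ) : ℝ :=
  dirDeriv (polarR b p.1 p.2) W (polarPt b p.1 p.2) *
      dirDeriv (polarT b p.2) W (polarPt b p.1 p.2) * polarWeight p.1 * Real.cos (2 * p.2) +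
    (1 / 2 * (dirDeriv (polarT b p.2) W (polarPt b p.1 p.2) ^ 2 -
        dirDeriv (polarR b p.1 p.2) W (polarPt b p.1 p.2) ^ 2) +
        6 * (Real.exp (W (polarPt b p.1 p.2)) - 1 - W (polarPt b p.1 p.2))) *
      (1 / 2 * (1 / 2 * Real.sin p.1 ^ 3 - polarWeight p.1 * Real.cos p.1)) *
      Real.sin (2 * p.2) +
    Real.sin p.1 ^ 2 * Real.cos (2 * p.2) * dirDeriv (polarT b p.2) W (polarPt b p.1 p.2) +
    2 * W (polarPt b p.1 p.2) * Real.sin p.1 * Real.sin (2 * p.2)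

/-- The divergence of the vector field in the Pohozaev-type identity. -/
noncomputable def fieldDiv (W : E3 → ℝ) (b : OrthonormalBasis (Fin 3) ℝ E3) (p : ℝ × ℝ) : ℝ :=
  dirDeriv (polarR b p.1 p.2) W (polarPt b p.1 p.2) *
    dirDeriv (polarT b p.2) W (polarPt b p.1 p.2) *
    (1 / 4 * Real.sin p.1 ^ 3 * Real.cos p.1 - 3 / 2 * polarWeight p.1) * Real.sin (2 * p.2)

theorem IsSol.differentiable_polar (hW : IsSol W) :
    (Differentiable ℝ fun p : ℝ × ℝ => W (polarPt b p.1 p.2)) ∧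
    (Differentiable ℝ fun p : ℝ × ℝ => dirDeriv (polarR b p.1 p.2) W (polarPt b p.1 p.2)) ∧
    (Differentiable ℝ fun p : ℝ × ℝ => dirDeriv (polarT b p.2) W (polarPt b p.1 p.2)) ∧
    Differentiable ℝ fun p : ℝ × ℝ => polarWeight p.1 := by
  have hP : Differentiable ℝ fun p : ℝ × ℝ => polarPt b p.1 p.2 := by unfold polarPt; fun_prop
  have hR : Differentiable ℝ fun p : ℝ × ℝ => polarR b p.1 p.2 := by unfold polarR; fun_prop
  have hT : Differentiable ℝ fun p : ℝ × ℝ => polarT b p.2 := by unfold polarT; fun_prop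
  have hd : Differentiable ℝ fun p : ℝ × ℝ => fderiv ℝ W (polarPt b p.1 p.2) := fun p =>
    (((hW.smooth _ (polarPt_ne_zero b p.1 p.2)).fderiv_right (m := 1)
      (by norm_cast)).differentiableAt (by norm_num)).comp p (hP p)
  exact ⟨fun p => (hW.smooth.differentiableAt (polarPt_ne_zero b p.1 p.2)).comp p (hP p),
    hd.clm_apply hR, hd.clm_apply hT, by unfold polarWeight; fun_prop⟩

theorem IsSol.differentiable_fieldR (hW : IsSol W) : Differentiable ℝ (fieldR W b) := by
  obtain ⟨h₁, h₂, h₃, h₄⟩ := hW.differentiable_polar b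
  have key : ∀ w D c a : ℝ × ℝ → ℝ, Differentiable ℝ w → Differentiable ℝ D → Differentiable ℝ c →
      Differentiable ℝ a → Differentiable ℝ fun p => Real.sin p.1 *
        ((1 / 2 * (D p ^ 2 - c p ^ 2) + 6 * (Real.exp (w p) - 1 - w p)) * a p * Real.cos (2 * p.2) +
          D p * c p * (1 / 2 * (1 / 2 * Real.sin p.1 ^ 3 - a p * Real.cos p.1)) *
            Real.sin (2 * p.2) +
          Real.sin p.1 ^ 2 * Real.cos (2 * p.2) * D p -
          w p * (2 * Real.sin p.1 * Real.cos p.1 * Real.cos (2 * p.2))) := by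
    intros
    fun_prop
  exact key _ _ _ _ h₁ h₂ h₃ h₄

theorem IsSol.differentiable_fieldT (hW : IsSol W) : Differentiable ℝ (fieldT W b) := by
  obtain ⟨h₁, h₂, h₃, h₄⟩ := hW.differentiable_polar b
  have key : ∀ w D c a : ℝ × ℝ → ℝ, Differentiable ℝ w → Differentiable ℝ D → Differentiable ℝ c →
      Differentiable ℝ a → Differentiable ℝ fun p =>
        D p * c p * a p * Real.cos (2 * p.2) +
          (1 / 2 * (c p ^ 2 - D p ^ 2) + 6 * (Real.exp (w p) - 1 - w p)) *
            (1 / 2 * (1 / 2 * Real.sin p.1 ^ 3 - a p * Real.cos p.1)) * Real.sin (2 * p.2) +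
          Real.sin p.1 ^ 2 * Real.cos (2 * p.2) * c p +
          2 * w p * Real.sin p.1 * Real.sin (2 * p.2) := by
    intros
    fun_prop
  exact key _ _ _ _ h₁ h₂ h₃ h₄

theorem IsSol.continuous_fieldDiv (hW : IsSol W) : Continuous (fieldDiv W b) := by
  obtain ⟨h₁, h₂, h₃, h₄⟩ := hW.differentiable_polar b
  have h₁ := h₁.continuous
  have h₂ := h₂.continuous
  have h₃ := h₃.continuous
  have h₄ := h₄.continuous
  unfold fieldDiv
  fun_prop

theorem IsSol.div_field (hW : IsSol W) :
    fderiv ℝ (fieldR W b) (r, t) (1, 0) + fderiv ℝ (fieldT W b) (r, t) (0, 1) =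
      fieldDiv W b (r, t) := by
  have h0 := polarPt_ne_zero b r t
  have hself := hW.homog.dirDeriv_self hW.smooth h0
  have hsymm : fderiv ℝ (fderiv ℝ W) (polarPt b r t) (polarT b t) (polarR b r t) =
      fderiv ℝ (fderiv ℝ W) (polarPt b r t) (polarR b r t) (polarT b t) := by
    rw [← hW.smooth.dirDeriv_dirDeriv_eq h0, ← hW.smooth.dirDeriv_dirDeriv_eq h0,
      hW.smooth.dirDeriv_comm h0]
  have hpde := hW.polar_pde b r t
  have hsc := Real.sin_sq_add_cos_sq r
  -- derivatives in `r`
  have hWr : HasDerivAt (fun r => W (polarPt b r t)) _ r :=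
    hW.smooth.hasDerivAt_comp (hasDerivAt_polarPt_r b r t) h0
  have hDr := hW.smooth.hasDerivAt_dirDeriv (hasDerivAt_polarPt_r b r t)
    (hasDerivAt_polarR_r b r t) h0
  have hcr := hW.smooth.hasDerivAt_dirDeriv (hasDerivAt_polarPt_r b r t)
    (hasDerivAt_const r (polarT b t)) h0
  rw [dirDeriv_neg_left, hself, neg_zero, add_zero] at hDr
  rw [show dirDeriv 0 W (polarPt b r t) = 0 from map_zero _, add_zero] at hcr
  -- derivatives in `t`
  have hWt : HasDerivAt (fun t => W (polarPt b r t)) _ t :=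
    hW.smooth.hasDerivAt_comp (hasDerivAt_polarPt_t b r t) h0
  have hDt := hW.smooth.hasDerivAt_dirDeriv (hasDerivAt_polarPt_t b r t)
    (hasDerivAt_polarR_t b r t) h0
  have hct := hW.smooth.hasDerivAt_dirDeriv (hasDerivAt_polarPt_t b r t)
    (hasDerivAt_polarT b r t) h0
  simp only [map_smul, smul_apply, smul_eq_mul, dirDeriv_smul_left,
    dirDeriv_neg_left, dirDeriv_add_left, hself, hsymm, mul_zero, zero_add] at hWt hDt hct
  have hR : HasDerivAt (fun r => fieldR W b (r, t)) (fderiv ℝ (fieldR W b) (r, t) (1, 0)) r :=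
    ((hW.differentiable_fieldR b (r, t)).hasFDerivAt).comp_hasDerivAt (f := fun r => (r, t)) r
      ((hasDerivAt_id r).prodMk (hasDerivAt_const r t))
  have hT : HasDerivAt (fun t => fieldT W b (r, t)) (fderiv ℝ (fieldT W b) (r, t) (0, 1)) t :=
    ((hW.differentiable_fieldT b (r, t)).hasFDerivAt).comp_hasDerivAt (f := fun t => (r, t)) t
      ((hasDerivAt_const t r).prodMk (hasDerivAt_id t))
  have hw := hasDerivAt_polarWeight r
  have hs := Real.hasDerivAt_sin r
  have hk := Real.hasDerivAt_cos r
  have h2t : HasDerivAt (fun t : ℝ => 2 * t) 2 t := by simpa using (hasDerivAt_id t).const_mul 2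
  have hS := h2t.sin
  have hC := h2t.cos
  have hF : ∀ {g : ℝ → ℝ} {g' s : ℝ}, HasDerivAt g g' s →
      HasDerivAt (fun s => 6 * (Real.exp (g s) - 1 - g s)) (6 * (Real.exp (g s) * g' - g')) s :=
    fun hg => ((hg.exp.sub_const 1).sub hg).const_mul 6
  have hsq : ∀ {g : ℝ → ℝ} {g' s : ℝ}, HasDerivAt g g' s →
      HasDerivAt (fun s => g s ^ 2) (2 * g s * g') s := fun hg => by
    simpa using hg.fun_pow 2
  have hbeta : HasDerivAt (fun r => 1 / 2 * (1 / 2 * Real.sin r ^ 3 - polarWeight r * Real.cos r))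
      (1 / 2 * (Real.sin r ^ 2 * Real.cos r + polarWeight r * Real.sin r)) r := by
    refine ((((hs.pow 3).const_mul (1 / 2 : ℝ)).sub (hw.mul hk)).const_mul
      (1 / 2 : ℝ)).congr_deriv ?_
    simp only [Nat.cast_ofNat, Nat.add_one_sub_one]
    ring
  have hR' := hs.mul (((((((hsq hDr).sub (hsq hcr)).const_mul (1 / 2 : ℝ)).add (hF hWr)).mul
    hw).mul_const (Real.cos (2 * t))).add (((hDr.mul hcr).mul hbeta).mul_const (Real.sin (2 * t)))
    |>.add (((hsq hs).mul_const (Real.cos (2 * t))).mul hDr) |>.sub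
    (hWr.mul (((hs.const_mul 2).mul hk).mul_const (Real.cos (2 * t)))))
  have hT' := (((((hDt.mul hct).mul_const (polarWeight r)).mul hC).add
    ((((((hsq hct).sub (hsq hDt)).const_mul (1 / 2 : ℝ)).add (hF hWt)).mul_const
    (1 / 2 * (1 / 2 * Real.sin r ^ 3 - polarWeight r * Real.cos r))).mul hS)).add
    ((hC.const_mul (Real.sin r ^ 2)).mul hct)).add
    (((hWt.const_mul 2).mul_const (Real.sin r)).mul hS)
  rw [hR.unique hR', hT.unique hT', fieldDiv]
  generalize fderiv ℝ (fderiv ℝ W) (polarPt b r t) (polarR b r t) (polarR b r t) = P at *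
  generalize fderiv ℝ (fderiv ℝ W) (polarPt b r t) (polarR b r t) (polarT b t) = Q at *
  generalize fderiv ℝ (fderiv ℝ W) (polarPt b r t) (polarT b t) (polarT b t) = R at *
  simp only [Pi.mul_apply, Pi.add_apply, Pi.sub_apply]
  generalize dirDeriv (polarR b r t) W (polarPt b r t) = D at *
  generalize dirDeriv (polarT b t) W (polarPt b r t) = c at *
  generalize W (polarPt b r t) = w at *
  generalize polarWeight r = a at *
  linear_combination (a * Real.cos (2 * t) * Real.sin r * D +
    c * (1 / 2 * (1 / 2 * Real.sin r ^ 3 - a * Real.cos r)) * Real.sin (2 * t) * Real.sin r +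
    Real.sin r ^ 3 * Real.cos (2 * t)) * hpde + (1 / 2 * a * D * c * Real.sin (2 * t) -
    4 * Real.sin r * w * Real.cos (2 * t)) * hsc

end MeanField

namespace MeanField

open Filter Topology ContDiff InnerProductSpace Laplacian MeasureTheory

variable {W : E3 → ℝ} (b : OrthonormalBasis (Fin 3) ℝ E3)

theorem inner_polarPt (r t : ℝ) : ⟪b 0, polarPt b r t⟫_ℝ = Real.sin r * Real.cos t ∧
    ⟪b 1, polarPt b r t⟫_ℝ = Real.sin r * Real.sin t ∧ ⟪b 2, polarPt b r t⟫_ℝ = Real.cos r := by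
  have hin := fun i j => orthonormal_iff_ite.mp b.orthonormal i j
  refine ⟨?_, ?_, ?_⟩ <;> simp [polarPt, inner_add_right, inner_smul_right, hin]

theorem IsSol.angular_mul_dirDeriv_polarPt (hW : IsSol W) (r t : ℝ) :
    angular W b 0 1 (polarPt b r t) * dirDeriv (b 2) W (polarPt b r t) =
      -(Real.sin r ^ 2 * (dirDeriv (polarR b r t) W (polarPt b r t) *
        dirDeriv (polarT b t) W (polarPt b r t))) := by
  obtain ⟨h0, h1, -⟩ := inner_polarPt b r t
  have hself := hW.homog.dirDeriv_self hW.smooth (polarPt_ne_zero b r t)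
  have hsc := Real.sin_sq_add_cos_sq r
  have h2 : b 2 = Real.cos r • polarPt b r t - Real.sin r • polarR b r t := by
    calc b 2 = (Real.sin r ^ 2 + Real.cos r ^ 2) • b 2 := by rw [hsc, one_smul]
      _ = _ := by unfold polarPt polarR; module
  have h3 : dirDeriv (b 2) W (polarPt b r t) =
      -(Real.sin r * dirDeriv (polarR b r t) W (polarPt b r t)) := by
    conv_lhs => rw [h2]
    rw [dirDeriv_sub_left, dirDeriv_smul_left, dirDeriv_smul_left, hself]
    ring
  rw [h3, angular, h0, h1, polarT, dirDeriv_add_left, dirDeriv_smul_left, dirDeriv_smul_left]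
  ring

theorem exists_polarPt {x : E3} (hx : ‖x‖ = 1) (hpos : ∀ i, 0 < ⟪b i, x⟫_ℝ) :
    ∃ r ∈ Set.Ioo 0 (π / 2), ∃ t ∈ Set.Ioo 0 (π / 2), polarPt b r t = x := by
  have hsum : ⟪b 0, x⟫_ℝ ^ 2 + ⟪b 1, x⟫_ℝ ^ 2 + ⟪b 2, x⟫_ℝ ^ 2 = 1 := (basis_inner_sums b hx hx).2.1
  have h0 := hpos 0
  have h1 := hpos 1
  have h2 := hpos 2
  have hx0 : x = ⟪b 0, x⟫_ℝ • b 0 + ⟪b 1, x⟫_ℝ • b 1 + ⟪b 2, x⟫_ℝ • b 2 := basis_repr b x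
  generalize ⟪b 0, x⟫_ℝ = X at *
  generalize ⟪b 1, x⟫_ℝ = Y at *
  generalize ⟪b 2, x⟫_ℝ = Z at *
  obtain ⟨ρ, hρ, hρsq⟩ : ∃ ρ : ℝ, 0 < ρ ∧ ρ ^ 2 = X ^ 2 + Y ^ 2 :=
    ⟨Real.sqrt (X ^ 2 + Y ^ 2), Real.sqrt_pos.mpr (by positivity), Real.sq_sqrt (by positivity)⟩
  have hZ1 : Z < 1 := by nlinarith
  have hX1 : X / ρ < 1 := by rw [div_lt_one hρ]; nlinarith
  have hc : Real.cos (Real.arccos Z) = Z := Real.cos_arccos (by linarith) hZ1.le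
  have hs : Real.sin (Real.arccos Z) = ρ := by
    rw [Real.sin_arccos, show 1 - Z ^ 2 = ρ ^ 2 by linarith, Real.sqrt_sq hρ.le]
  have hc' : Real.cos (Real.arccos (X / ρ)) = X / ρ :=
    Real.cos_arccos (by linarith [div_pos h0 hρ]) hX1.le
  have hs' : Real.sin (Real.arccos (X / ρ)) = Y / ρ := by
    rw [Real.sin_arccos, show 1 - (X / ρ) ^ 2 = (Y / ρ) ^ 2 by field_simp; linarith,
      Real.sqrt_sq (by positivity)]
  refine ⟨Real.arccos Z, ⟨Real.arccos_pos.mpr hZ1, Real.arccos_lt_pi_div_two.mpr h2⟩,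
    Real.arccos (X / ρ), ⟨Real.arccos_pos.mpr hX1, Real.arccos_lt_pi_div_two.mpr (by positivity)⟩,
    ?_⟩
  rw [polarPt, hc, hs, hc', hs', mul_div_cancel₀ _ hρ.ne', mul_div_cancel₀ _ hρ.ne']
  exact hx0.symm

theorem IsSol.integral_fieldDiv (hW : IsSol W) (hs : ∀ i, MirrorSymm W (b i)) :
    ∫ p in Set.Icc ((0 : ℝ), (0 : ℝ)) (π / 2, π / 2), fieldDiv W b p = 0 := by
  have hint : IntegrableOn (fieldDiv W b) (Set.Icc ((0 : ℝ), (0 : ℝ)) (π / 2, π / 2)) :=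
    (hW.continuous_fieldDiv b).continuousOn.integrableOn_Icc
  have hdiv : (fun p : ℝ × ℝ => fderiv ℝ (fieldR W b) p (1, 0) + fderiv ℝ (fieldT W b) p (0, 1)) =
      fieldDiv W b := funext fun p => hW.div_field b p.1 p.2
  have h := integral_divergence_prod_Icc_of_hasFDerivAt_of_le (fieldR W b) (fieldT W b)
    (fderiv ℝ (fieldR W b)) (fderiv ℝ (fieldT W b)) (0, 0) (π / 2, π / 2)
    ⟨by positivity, by positivity⟩ (hW.differentiable_fieldR b).continuous.continuousOn
    (hW.differentiable_fieldT b).continuous.continuousOn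
    (fun p _ => (hW.differentiable_fieldR b p).hasFDerivAt)
    (fun p _ => (hW.differentiable_fieldT b p).hasFDerivAt) (by rw [hdiv]; exact hint)
  have h1 : ∀ r, fieldT W b (r, π / 2) = 0 := fun r => by
    have hc : dirDeriv (polarT b (π / 2)) W (polarPt b r (π / 2)) = 0 := by
      rw [polarT, dirDeriv_add_left, dirDeriv_smul_left, dirDeriv_smul_left,
        (hs 0).dirDeriv_eq_zero hW.smooth (by simp) (polarPt_ne_zero _ _ _)
          (by simp [(inner_polarPt b r (π / 2)).1])]
      simp
    simp [fieldT, hc, show 2 * (π / 2) = π by ring]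
  have h2 : ∀ r, fieldT W b (r, 0) = 0 := fun r => by
    have hc : dirDeriv (polarT b 0) W (polarPt b r 0) = 0 := by
      rw [polarT, dirDeriv_add_left, dirDeriv_smul_left, dirDeriv_smul_left,
        (hs 1).dirDeriv_eq_zero hW.smooth (by simp) (polarPt_ne_zero _ _ _)
          (by simp [(inner_polarPt b r 0).2.1])]
      simp
    simp [fieldT, hc]
  have h3 : ∀ t, fieldR W b (π / 2, t) = 0 := fun t => by
    have hc : dirDeriv (polarR b (π / 2) t) W (polarPt b (π / 2) t) = 0 := by
      rw [polarR, dirDeriv_sub_left, dirDeriv_add_left, dirDeriv_smul_left, dirDeriv_smul_left,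
        dirDeriv_smul_left, (hs 2).dirDeriv_eq_zero hW.smooth (by simp) (polarPt_ne_zero _ _ _)
          (by simp [(inner_polarPt b (π / 2) t).2.2])]
      simp
    have hw : polarWeight (π / 2) = 0 := by
      simp [polarWeight]
      ring
    simp [fieldR, hc, hw]
  have h4 : ∀ t, fieldR W b (0, t) = 0 := fun t => by simp [fieldR]
  simp only [h1, h2, h3, h4, intervalIntegral.integral_zero, sub_zero, add_zero] at h
  rw [hdiv] at h
  exact h

/-- On an octant bounded by symmetry planes, the product of the rotational derivative about an axis
and the derivative along that axis cannot have a strict sign. -/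
theorem IsSol.angular_mul_dirDeriv_eq_zero (hW : IsSol W) (hs : ∀ i, MirrorSymm W (b i)) {ε : ℝ}
    (hε : ε ≠ 0)
    (hsign : ∀ x : E3, ‖x‖ = 1 → (∀ i, 0 < ⟪b i, x⟫_ℝ) →
      0 ≤ ε * (angular W b 0 1 x * dirDeriv (b 2) W x))
    {x : E3} (hx : ‖x‖ = 1) (hpos : ∀ i, 0 < ⟪b i, x⟫_ℝ) :
    angular W b 0 1 x * dirDeriv (b 2) W x = 0 := by
  have hkappa : ∀ r, 0 < r → r < π / 2 →
      0 < 1 / 4 * Real.sin r ^ 3 * Real.cos r - 3 / 2 * polarWeight r := fun r h0 h1 => by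
    have hsin := Real.sin_pos_of_pos_of_lt_pi h0 (by linarith)
    have hcos := Real.cos_pos_of_mem_Ioo ⟨by linarith, h1⟩
    have : 0 < Real.sin r * Real.cos r := by positivity
    have h3 : 0 < Real.sin r ^ 3 * Real.cos r := by positivity
    unfold polarWeight
    linarith
  have hcrit : ∀ t, dirDeriv (polarT b t) W (polarPt b 0 t) = 0 := fun t => by
    have : polarPt b 0 t = b 2 := by simp [polarPt]
    rw [this]
    exact hW.dirDeriv_pole (by simp) (hs 2) _
  have hnonneg : ∀ p ∈ Set.Icc ((0 : ℝ), (0 : ℝ)) (π / 2, π / 2),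
      0 ≤ -ε * fieldDiv W b p := by
    rintro ⟨r, t⟩ ⟨⟨hr0, ht0⟩, hr1, ht1⟩
    simp only at hr0 ht0 hr1 ht1
    rcases hr0.eq_or_lt with rfl | hr0
    · simp [fieldDiv, hcrit]
    rcases ht0.eq_or_lt with rfl | ht0
    · simp [fieldDiv]
    rcases hr1.eq_or_lt with rfl | hr1
    · simp [fieldDiv, polarWeight]
      ring_nf
      simp
    rcases ht1.eq_or_lt with rfl | ht1
    · simp [fieldDiv, show 2 * (π / 2) = π by ring]
    have hsin := Real.sin_pos_of_pos_of_lt_pi hr0 (by linarith)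
    have hsint := Real.sin_pos_of_pos_of_lt_pi ht0 (by linarith)
    have hcos := Real.cos_pos_of_mem_Ioo ⟨by linarith, hr1⟩
    have hcost := Real.cos_pos_of_mem_Ioo ⟨by linarith, ht1⟩
    have h2t := Real.sin_pos_of_pos_of_lt_pi (x := 2 * t) (by linarith) (by linarith)
    obtain ⟨i0, i1, i2⟩ := inner_polarPt b r t
    have h := hsign (polarPt b r t) (norm_polarPt b r t) (fun i => by
      fin_cases i
      · exact i0 ▸ (by positivity)
      · exact i1 ▸ (by positivity)
      · exact i2 ▸ hcos)
    rw [hW.angular_mul_dirDeriv_polarPt b] at h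
    have h' : 0 ≤ -ε * (dirDeriv (polarR b r t) W (polarPt b r t) *
        dirDeriv (polarT b t) W (polarPt b r t)) := by
      refine nonneg_of_mul_nonneg_right (a := Real.sin r ^ 2) ?_ (by positivity)
      linarith
    have hk := hkappa r hr0 hr1
    have := mul_nonneg h' (mul_pos hk h2t).le
    simp only [fieldDiv]
    linarith
  have hcont : Continuous fun p => -ε * fieldDiv W b p :=
    continuous_const.mul (hW.continuous_fieldDiv b)
  have hint : ∫ p in Set.Icc ((0 : ℝ), (0 : ℝ)) (π / 2, π / 2), -ε * fieldDiv W b p = 0 := by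
    rw [integral_const_mul, hW.integral_fieldDiv b hs, mul_zero]
  rw [setIntegral_eq_zero_iff_of_nonneg_ae
    ((ae_restrict_mem measurableSet_Icc).mono hnonneg) hcont.continuousOn.integrableOn_Icc] at hint
  obtain ⟨r, hr, t, ht, rfl⟩ := exists_polarPt b hx hpos
  have hsub : Set.Ioo 0 (π / 2) ×ˢ Set.Ioo 0 (π / 2) ⊆
      Set.Icc ((0 : ℝ), (0 : ℝ)) (π / 2, π / 2) := fun p hp =>
    ⟨⟨hp.1.1.le, hp.2.1.le⟩, hp.1.2.le, hp.2.2.le⟩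
  have hzero := Measure.eqOn_open_of_ae_eq (ae_restrict_of_ae_restrict_of_subset hsub hint)
    (isOpen_Ioo.prod isOpen_Ioo) hcont.continuousOn continuousOn_const (x := (r, t)) ⟨hr, ht⟩
  have h2t := Real.sin_pos_of_pos_of_lt_pi (x := 2 * t) (by linarith [ht.1]) (by linarith [ht.2])
  have hk := hkappa r hr.1 hr.2
  rw [hW.angular_mul_dirDeriv_polarPt b]
  have : dirDeriv (polarR b r t) W (polarPt b r t) *
      dirDeriv (polarT b t) W (polarPt b r t) = 0 := by
    have hz : -ε * fieldDiv W b (r, t) = 0 := hzero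
    simp only [fieldDiv, mul_eq_zero, neg_eq_zero, hε, hk.ne', h2t.ne', or_false, false_or] at hz
    exact mul_eq_zero.mpr hz
  rw [this]
  simp

end MeanField

namespace MeanField

open Filter Topology ContDiff InnerProductSpace Laplacian

variable {W : E3 → ℝ} (b : OrthonormalBasis (Fin 3) ℝ E3)

/-- The open octant spanned by an orthonormal frame. -/
def octant : Set E3 := {y | ∀ i, 0 < ⟪b i, y⟫_ℝ}

variable {b}

theorem ne_zero_of_mem_octant {y : E3} (hy : y ∈ octant b) : y ≠ 0 := by
  rintro rfl
  simpa using hy 0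

theorem smul_mem_octant {y : E3} (hy : y ∈ octant b) {c : ℝ} (hc : 0 < c) :
    c • y ∈ octant b := fun i => by
  rw [inner_smul_right]
  exact mul_pos hc (hy i)

variable (b)

theorem convex_octant : Convex ℝ (octant b) := by
  intro x hx y hy s t hs ht hst i
  rw [inner_add_right, inner_smul_right, inner_smul_right]
  rcases hs.eq_or_lt with rfl | hs
  · have : t = 1 := by linarith
    subst this
    simpa using hy i
  · exact add_pos_of_pos_of_nonneg (mul_pos hs (hx i)) (mul_nonneg ht (hy i).le)

theorem isOpen_octant : IsOpen (octant b) := by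
  simp only [octant, Set.ofPred_forall]
  exact isOpen_iInter_of_finite fun i => isOpen_lt continuous_const (by fun_prop)

theorem angular_weak_sign (hW : IsSol W) (hs : ∀ i, MirrorSymm W (b i)) :
    ∃ ε : ℝ, ε ≠ 0 ∧ ∀ y ∈ octant b, 0 ≤ ε * angular W b 0 1 y := by
  by_cases hz : ∃ y ∈ octant b, angular W b 0 1 y = 0
  · obtain ⟨y, hy, h0⟩ := hz
    have hy0 := ne_zero_of_mem_octant hy
    have hc : 0 < ‖y‖⁻¹ := by positivity
    refine ⟨1, one_ne_zero, fun z hz => ?_⟩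
    rw [angular_eq_zero_of_apply_eq_zero hW b hs (norm_inv_norm_smul hy0)
      (fun i => (smul_mem_octant hy hc i).ne') _ (ne_zero_of_mem_octant hz), mul_zero]
    rw [angular] at h0 ⊢
    simp only [inner_smul_right, hW.homog.dirDeriv_smul hc]
    rw [← h0]
    field_simp
  · have hcont : ContinuousOn (angular W b 0 1) (octant b) := fun y hy => by
      have hy0 := ne_zero_of_mem_octant hy
      have h0 := (hW.smooth.dirDeriv (b 0)).continuousAt hy0
      have h1 := (hW.smooth.dirDeriv (b 1)).continuousAt hy0
      unfold angular
      exact ContinuousAt.continuousWithinAt (by fun_prop)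
    have hpre := (convex_octant b).isPreconnected
    by_cases hneg : ∃ y ∈ octant b, angular W b 0 1 y < 0
    · obtain ⟨y, hy, hy0⟩ := hneg
      refine ⟨-1, by norm_num, fun z hz' => ?_⟩
      by_contra hlt
      obtain ⟨p, hp, hp0⟩ := hpre.intermediate_value hy hz' hcont
        (show (0 : ℝ) ∈ Set.Icc _ _ from ⟨hy0.le, by linarith⟩)
      exact hz ⟨p, hp, hp0⟩
    · push Not at hneg
      exact ⟨1, one_ne_zero, fun y hy => by simpa using hneg y hy⟩

/-- The frame obtained by a cyclic permutation. -/
noncomputable def cycle : OrthonormalBasis (Fin 3) ℝ E3 := b.reindex (finRotate 3).symm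

@[simp] theorem cycle_apply (i : Fin 3) : cycle b i = b (i + 1) := by
  simp [cycle]

theorem octant_cycle : octant (cycle b) = octant b := by
  ext y
  simp only [octant, cycle_apply, Set.mem_ofPred_eq]
  refine ⟨fun h i => ?_, fun h i => h _⟩
  simpa using h (i - 1)

theorem angular_cycle (i j : Fin 3) (y : E3) :
    angular W (cycle b) i j y = angular W b (i + 1) (j + 1) y := by
  simp [angular]

theorem IsSol.sum_inner_mul_dirDeriv (hW : IsSol W) {y : E3} (hy : y ≠ 0) :
    ⟪b 0, y⟫_ℝ * dirDeriv (b 0) W y + ⟪b 1, y⟫_ℝ * dirDeriv (b 1) W y +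
      ⟪b 2, y⟫_ℝ * dirDeriv (b 2) W y = 0 := by
  have h := hW.homog.dirDeriv_self hW.smooth hy
  conv_lhs at h => rw [show dirDeriv y W y = dirDeriv (⟪b 0, y⟫_ℝ • b 0 + ⟪b 1, y⟫_ℝ • b 1 +
    ⟪b 2, y⟫_ℝ • b 2) W y by rw [← basis_repr]]
  simpa only [dirDeriv_add_left, dirDeriv_smul_left] using h

end MeanField

namespace MeanField

open Filter Topology ContDiff InnerProductSpace Laplacian

variable {W : E3 → ℝ} (b : OrthonormalBasis (Fin 3) ℝ E3)

theorem cycle_mirrorSymm (hs : ∀ i, MirrorSymm W (b i)) (i : Fin 3) :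
    MirrorSymm W (cycle b i) := by
  rw [cycle_apply]
  exact hs _

/-- If two angular derivatives have the same sign on an octant, the gradient vanishes there. -/
theorem IsSol.dirDeriv_eq_zero_of_same_sign (hW : IsSol W) (hs : ∀ i, MirrorSymm W (b i)) {ε : ℝ}
    (hε : ε ≠ 0) (hp : ∀ y ∈ octant b, 0 ≤ ε * angular W b 0 1 y)
    (hq : ∀ y ∈ octant b, 0 ≤ ε * angular W b 1 2 y) {x : E3} (hx : ‖x‖ = 1)
    (hxb : x ∈ octant b) (i : Fin 3) : dirDeriv (b i) W x = 0 := by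
  have key : ∀ y : E3, ‖y‖ = 1 → y ∈ octant b →
      (dirDeriv (b 2) W y = ⟪b 1, y⟫_ℝ * angular W b 1 2 y - ⟪b 0, y⟫_ℝ * angular W b 2 0 y ∧
      dirDeriv (b 0) W y = ⟪b 2, y⟫_ℝ * angular W b 2 0 y - ⟪b 1, y⟫_ℝ * angular W b 0 1 y ∧
      dirDeriv (b 1) W y = ⟪b 0, y⟫_ℝ * angular W b 0 1 y - ⟪b 2, y⟫_ℝ * angular W b 1 2 y) ∧
      ⟪b 2, y⟫_ℝ * angular W b 0 1 y + ⟪b 0, y⟫_ℝ * angular W b 1 2 y +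
        ⟪b 1, y⟫_ℝ * angular W b 2 0 y = 0 := fun y hy hyb => by
    have hsum : ⟪b 0, y⟫_ℝ ^ 2 + ⟪b 1, y⟫_ℝ ^ 2 + ⟪b 2, y⟫_ℝ ^ 2 = 1 :=
      (basis_inner_sums b hy hy).2.1
    have hself := hW.sum_inner_mul_dirDeriv b (ne_zero_of_mem_octant hyb)
    simp only [angular]
    refine ⟨⟨?_, ?_, ?_⟩, by ring⟩
    · linear_combination (-dirDeriv (b 2) W y) * hsum + ⟪b 2, y⟫_ℝ * hself
    · linear_combination (-dirDeriv (b 0) W y) * hsum + ⟪b 0, y⟫_ℝ * hself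
    · linear_combination (-dirDeriv (b 1) W y) * hsum + ⟪b 1, y⟫_ℝ * hself
  have hε2 : 0 < ε ^ 2 := by positivity
  have signs : ∀ y : E3, ‖y‖ = 1 → y ∈ octant b →
      0 ≤ angular W b 0 1 y * angular W b 1 2 y ∧ angular W b 0 1 y * angular W b 2 0 y ≤ 0 ∧
      angular W b 1 2 y * angular W b 2 0 y ≤ 0 := fun y hy hyb => by
    have hlin := (key y hy hyb).2
    have h0 := hyb 0
    have h1 := hyb 1
    have h2 := hyb 2
    have hpq : 0 ≤ angular W b 0 1 y * angular W b 1 2 y := by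
      refine nonneg_of_mul_nonneg_right (a := ε ^ 2) ?_ hε2
      linarith [mul_nonneg (hp y hyb) (hq y hyb)]
    refine ⟨hpq, ?_, ?_⟩
    · refine nonpos_of_mul_nonpos_right (a := ⟪b 1, y⟫_ℝ) ?_ h1
      have e1 := mul_nonneg h0.le hpq
      have e2 := mul_nonneg h2.le (sq_nonneg (angular W b 0 1 y))
      linear_combination e1 + e2 + angular W b 0 1 y * hlin
    · refine nonpos_of_mul_nonpos_right (a := ⟪b 1, y⟫_ℝ) ?_ h1
      have e1 := mul_nonneg h2.le hpq
      have e2 := mul_nonneg h0.le (sq_nonneg (angular W b 1 2 y))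
      linear_combination e1 + e2 + angular W b 1 2 y * hlin
  obtain ⟨⟨hv2, hv0, hv1⟩, hlin⟩ := key x hx hxb
  obtain ⟨hpq, hpr, hqr⟩ := signs x hx hxb
  have h0 := hxb 0
  have h1 := hxb 1
  have h2 := hxb 2
  have ax2 := hW.angular_mul_dirDeriv_eq_zero b hs (one_ne_zero' ℝ) (fun y hy hyb => by
    obtain ⟨⟨e2, -, -⟩, -⟩ := key y hy hyb
    obtain ⟨s1, s2, -⟩ := signs y hy hyb
    rw [e2]
    linear_combination mul_nonneg (hyb 1).le s1 + mul_nonneg (hyb 0).le (neg_nonneg.mpr s2))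
    hx hxb
  have ax0 := hW.angular_mul_dirDeriv_eq_zero (cycle b) (cycle_mirrorSymm b hs)
    (neg_ne_zero.mpr (one_ne_zero' ℝ)) (fun y hy hyb => by
      replace hyb : y ∈ octant b := octant_cycle b ▸ hyb
      obtain ⟨⟨-, e0, -⟩, -⟩ := key y hy hyb
      obtain ⟨s1, -, s3⟩ := signs y hy hyb
      rw [angular_cycle, cycle_apply]
      change 0 ≤ -1 * (angular W b 1 2 y * dirDeriv (b 0) W y)
      rw [e0]
      linear_combination mul_nonneg (hyb 1).le s1 + mul_nonneg (hyb 2).le (neg_nonneg.mpr s3))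
    hx (octant_cycle b ▸ hxb : x ∈ octant (cycle b))
  rw [angular_cycle, cycle_apply] at ax0
  replace ax0 : angular W b 1 2 x * dirDeriv (b 0) W x = 0 := ax0
  rw [hv2] at ax2
  rw [hv0] at ax0
  generalize angular W b 0 1 x = p at *
  generalize angular W b 1 2 x = q at *
  generalize angular W b 2 0 x = r at *
  have epq : p * q = 0 := by
    have := mul_nonneg h0.le (neg_nonneg.mpr hpr)
    have : ⟪b 1, x⟫_ℝ * (p * q) = 0 :=
      le_antisymm (by linear_combination this + ax2) (mul_nonneg h1.le hpq)
    exact (mul_eq_zero.mp this).resolve_left h1.ne'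
  have epr : p * r = 0 := by
    have : ⟪b 0, x⟫_ℝ * (p * r) = 0 := by linear_combination ⟪b 1, x⟫_ℝ * epq - ax2
    exact (mul_eq_zero.mp this).resolve_left h0.ne'
  have eqr : q * r = 0 := by
    have : ⟪b 2, x⟫_ℝ * (q * r) = 0 := by linear_combination ⟪b 1, x⟫_ℝ * epq + ax0
    exact (mul_eq_zero.mp this).resolve_left h2.ne'
  have ep : p = 0 := by
    have : ⟪b 2, x⟫_ℝ * p ^ 2 = 0 := by
      linear_combination p * hlin - ⟪b 0, x⟫_ℝ * epq - ⟪b 1, x⟫_ℝ * epr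
    exact pow_eq_zero_iff two_ne_zero |>.mp ((mul_eq_zero.mp this).resolve_left h2.ne')
  have eq : q = 0 := by
    have : ⟪b 0, x⟫_ℝ * q ^ 2 = 0 := by
      linear_combination q * hlin - ⟪b 2, x⟫_ℝ * epq - ⟪b 1, x⟫_ℝ * eqr
    exact pow_eq_zero_iff two_ne_zero |>.mp ((mul_eq_zero.mp this).resolve_left h0.ne')
  have er : r = 0 := by
    subst ep eq
    simpa [h1.ne'] using hlin
  subst ep eq er
  fin_cases i
  · simpa using hv0
  · simpa using hv1
  · simpa using hv2

theorem IsSol.dirDeriv_eq_zero_of_mem_octant (hW : IsSol W) (hs : ∀ i, MirrorSymm W (b i))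
    {x : E3} (hxb : x ∈ octant b) (v : E3) : dirDeriv v W x = 0 := by
  suffices h : ∀ x : E3, ‖x‖ = 1 → x ∈ octant b → ∀ i, dirDeriv (b i) W x = 0 by
    have hx0 := ne_zero_of_mem_octant hxb
    have hc : 0 < ‖x‖⁻¹ := by positivity
    have h' := h _ (norm_inv_norm_smul hx0) (smul_mem_octant hxb hc)
    simp only [hW.homog.dirDeriv_smul hc, mul_eq_zero, inv_eq_zero, hc.ne', false_or] at h'
    rw [basis_repr b v, dirDeriv_add_left, dirDeriv_add_left, dirDeriv_smul_left,
      dirDeriv_smul_left, dirDeriv_smul_left, h', h', h']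
    simp
  clear hxb x
  intro x hx hxb
  have hs' := cycle_mirrorSymm b hs
  have hs'' := cycle_mirrorSymm _ hs'
  obtain ⟨ε₁, hε₁, h₁⟩ := angular_weak_sign b hW hs
  obtain ⟨ε₂, hε₂, h₂⟩ := angular_weak_sign _ hW hs'
  obtain ⟨ε₃, hε₃, h₃⟩ := angular_weak_sign _ hW hs''
  simp only [octant_cycle, angular_cycle] at h₂ h₃
  have scale : ∀ {a c φ : ℝ}, 0 < a * c → 0 ≤ c * φ → 0 ≤ a * φ := fun {a c φ} hac h => by
    have hc : c ≠ 0 := by rintro rfl; simp at hac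
    refine nonneg_of_mul_nonneg_right (a := c ^ 2) ?_ (by positivity)
    linear_combination mul_nonneg hac.le h
  have hpair : 0 < ε₁ * ε₂ ∨ 0 < ε₂ * ε₃ ∨ 0 < ε₃ * ε₁ := by
    rcases hε₁.lt_or_gt with h | h <;> rcases hε₂.lt_or_gt with h' | h' <;>
      rcases hε₃.lt_or_gt with h'' | h'' <;> simp [mul_pos_iff, *]
  rcases hpair with h | h | h
  · exact hW.dirDeriv_eq_zero_of_same_sign b hs hε₁ h₁ (fun y hy => scale h (h₂ y hy)) hx hxb
  · intro i
    have := hW.dirDeriv_eq_zero_of_same_sign (cycle b) hs' hε₂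
      (by simpa only [octant_cycle, angular_cycle] using h₂)
      (fun y hy => by
        rw [octant_cycle] at hy
        rw [angular_cycle]
        exact scale h (h₃ y hy)) hx (octant_cycle b ▸ hxb) (i - 1)
    simpa using this
  · intro i
    have := hW.dirDeriv_eq_zero_of_same_sign (cycle (cycle b)) hs'' hε₃
      (by simpa only [octant_cycle, angular_cycle] using h₃)
      (fun y hy => by
        rw [octant_cycle, octant_cycle] at hy
        rw [angular_cycle, angular_cycle]
        exact scale h (h₁ y hy)) hx (by rwa [octant_cycle, octant_cycle]) (i - 1 - 1)
    simpa using this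

end MeanField

namespace MeanField

open Filter Topology ContDiff InnerProductSpace Laplacian

variable {W : E3 → ℝ} (b : OrthonormalBasis (Fin 3) ℝ E3)

theorem IsSol.eq_zero_of_eventually (hW : IsSol W) {y : E3} (hy : y ≠ 0)
    (h : ∀ᶠ z in 𝓝 y, ∀ v, dirDeriv v W z = 0) : W y = 0 := by
  have hlap : Δ W y = 0 := by
    rw [laplacian_eq_sum hW.smooth hy (EuclideanSpace.basisFun (Fin 3) ℝ)]
    refine Finset.sum_eq_zero fun i _ => ?_
    rw [dirDeriv_congr (g := fun _ => 0) (h.mono fun z hz => hz _)]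
    simp [dirDeriv]
  have hpde := hW.pde y hy
  rw [hlap, mul_zero] at hpde
  exact Real.exp_eq_one_iff _ |>.mp (by linarith)

theorem IsSol.eq_zero_of_frame (hW : IsSol W) (hs : ∀ i, MirrorSymm W (b i)) {y : E3}
    (hy : y ≠ 0) : W y = 0 := by
  have hin := fun i j => orthonormal_iff_ite.mp b.orthonormal i j
  have hoct : ∀ z ∈ octant b, W z = 0 := fun z hz =>
    hW.eq_zero_of_eventually (ne_zero_of_mem_octant hz) <| by
      filter_upwards [(isOpen_octant b).mem_nhds hz] with p hp v using
        hW.dirDeriv_eq_zero_of_mem_octant b hs hp v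
  let P : ℝ → ℝ → ℝ → E3 := fun r s t => r • b 0 + s • b 1 + t • b 2
  have hP : ∀ r s t, ⟪b 0, P r s t⟫_ℝ = r ∧ ⟪b 1, P r s t⟫_ℝ = s ∧ ⟪b 2, P r s t⟫_ℝ = t :=
    fun r s t => by
      refine ⟨?_, ?_, ?_⟩ <;> simp [P, inner_add_right, inner_smul_right, hin]
  have hflip : ∀ r s t, W (P (-r) s t) = W (P r s t) ∧ W (P r (-s) t) = W (P r s t) ∧
      W (P r s (-t)) = W (P r s t) := fun r s t => by
    obtain ⟨h0, h1, h2⟩ := hP r s t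
    refine ⟨?_, ?_, ?_⟩
    · rw [← hs 0 (P r s t), mirror_apply (by simp), h0]
      congr 1
      simp only [P]
      module
    · rw [← hs 1 (P r s t), mirror_apply (by simp), h1]
      congr 1
      simp only [P]
      module
    · rw [← hs 2 (P r s t), mirror_apply (by simp), h2]
      congr 1
      simp only [P]
      module
  have habs : ∀ r s t, W (P |r| |s| |t|) = W (P r s t) := fun r s t => by
    rcases abs_choice r with h | h <;> rcases abs_choice s with h' | h' <;>
      rcases abs_choice t with h'' | h'' <;> simp only [h, h', h'', (hflip _ _ _).1,
        (hflip _ _ _).2.1, (hflip _ _ _).2.2]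
  have hne : P |⟪b 0, y⟫_ℝ| |⟪b 1, y⟫_ℝ| |⟪b 2, y⟫_ℝ| ≠ 0 := fun h => hy <| by
    obtain ⟨h0, h1, h2⟩ := hP |⟪b 0, y⟫_ℝ| |⟪b 1, y⟫_ℝ| |⟪b 2, y⟫_ℝ|
    rw [h, inner_zero_right, eq_comm, abs_eq_zero] at h0 h1 h2
    rw [basis_repr b y, h0, h1, h2]
    simp
  rw [basis_repr b y]
  change W (P _ _ _) = 0
  rw [← habs]
  have hcont : ContinuousAt (fun u : ℝ =>
      P (|⟪b 0, y⟫_ℝ| + u) (|⟪b 1, y⟫_ℝ| + u) (|⟪b 2, y⟫_ℝ| + u)) 0 := by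
    simp only [P]
    fun_prop
  have hlim := ContinuousAt.comp (g := W) (hW.smooth.continuousAt (by simpa using hne)) hcont
  have hlim' := hlim.tendsto.mono_left (nhdsWithin_le_nhds (s := Set.Ioi 0))
  have hzero : Tendsto (W ∘ fun u : ℝ =>
      P (|⟪b 0, y⟫_ℝ| + u) (|⟪b 1, y⟫_ℝ| + u) (|⟪b 2, y⟫_ℝ| + u)) (𝓝[>] 0) (𝓝 0) := by
    refine tendsto_const_nhds.congr' ?_
    filter_upwards [self_mem_nhdsWithin] with u hu
    have hu : 0 < u := hu
    refine (hoct _ fun i => ?_).symm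
    obtain ⟨h0, h1, h2⟩ := hP (|⟪b 0, y⟫_ℝ| + u) (|⟪b 1, y⟫_ℝ| + u) (|⟪b 2, y⟫_ℝ| + u)
    fin_cases i
    · exact h0.symm ▸ (by positivity)
    · exact h1.symm ▸ (by positivity)
    · exact h2.symm ▸ (by positivity)
  simpa using tendsto_nhds_unique hlim' hzero

theorem IsSol.eq_zero (hW : IsSol W) {x : E3} (hx : x ≠ 0) : W x = 0 := by
  by_cases hne : ∃ x₁ x₂ : E3, ‖x₁‖ = 1 ∧ ‖x₂‖ = 1 ∧ W x₁ ≠ W x₂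
  · obtain ⟨x₁, x₂, h₁, h₂, hne⟩ := hne
    obtain ⟨b, hb⟩ := hW.exists_frame h₁ h₂ hne
    exact hW.eq_zero_of_frame b hb hx
  · push Not at hne
    refine hW.eq_zero_of_eventually hx ?_
    filter_upwards [eventually_ne_nhds hx] with z hz v
    rw [dirDeriv_congr (g := fun _ => W z)]
    · simp [dirDeriv]
    · filter_upwards [eventually_ne_nhds hz] with p hp
      rw [← hW.homog.eq_of_sphere hp, ← hW.homog.eq_of_sphere hz]
      exact hne _ _ (norm_inv_norm_smul hp) (norm_inv_norm_smul hz)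

theorem HomogZero.laplacian_smul {f : E3 → ℝ} (hf : HomogZero f) (hs : SmoothOff f) {c : ℝ}
    (hc : 0 < c) {y : E3} (hy : y ≠ 0) : Δ f (c • y) = c⁻¹ ^ 2 * Δ f y := by
  let e := EuclideanSpace.basisFun (Fin 3) ℝ
  rw [laplacian_eq_sum hs (smul_ne_zero hc.ne' hy) e, laplacian_eq_sum hs hy e, Finset.mul_sum]
  refine Finset.sum_congr rfl fun i _ => ?_
  have h : (fun z => dirDeriv (e i) f (c • z)) = fun z => c⁻¹ * dirDeriv (e i) f z :=
    funext fun z => hf.dirDeriv_smul hc _ z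
  have h1 := fderiv_comp_smul (𝕜 := ℝ) (f := dirDeriv (e i) f) (x := y) c
  rw [h, fderiv_const_mul ((hs.dirDeriv _).differentiableAt hy)] at h1
  have h2 := congrArg (fun L => c⁻¹ * L (e i)) h1
  simp only [smul_apply, smul_eq_mul] at h2
  rw [dirDeriv, dirDeriv]
  rw [inv_mul_cancel_left₀ hc.ne'] at h2
  linear_combination -h2

theorem isSol_of_sphere {w : E3 → ℝ} (hs : SmoothOff fun y => w (‖y‖⁻¹ • y))
    (hpde : ∀ x : E3, ‖x‖ = 1 → Δ (fun y => w (‖y‖⁻¹ • y)) x = 6 - 6 * Real.exp (w x))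
    (heven : ∀ x : E3, ‖x‖ = 1 → w (-x) = w x) : IsSol fun y => w (‖y‖⁻¹ • y) := by
  have hhom : HomogZero fun y => w (‖y‖⁻¹ • y) := fun c hc y => by
    rcases eq_or_ne y 0 with rfl | hy
    · simp
    have : ‖y‖ ≠ 0 := norm_ne_zero_iff.mpr hy
    simp only [norm_smul, Real.norm_eq_abs, abs_of_pos hc, smul_smul]
    congr 2
    field_simp
  refine ⟨hs, hhom, fun y => ?_, fun y hy => ?_⟩
  · rcases eq_or_ne y 0 with rfl | hy
    · simp
    · rw [norm_neg, smul_neg]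
      exact heven _ (norm_inv_norm_smul hy)
  · have h := hpde _ (norm_inv_norm_smul hy)
    rw [hhom.laplacian_smul hs (by positivity) hy, inv_inv] at h
    exact h

end MeanField

/-- Any smooth even solution of `Δ w = 6 - 6 e^w` on the round sphere vanishes
identically. -/
theorem stmt_15 (w : EuclideanSpace ℝ (Fin 3) → ℝ)
    (hsmooth : ContDiffOn ℝ (⊤ : ℕ∞) (fun y => w (‖y‖⁻¹ • y)) {y | y ≠ 0})
    (hPDE : ∀ x, ‖x‖ = 1 → sphereLaplacian w x = 6 - 6 * Real.exp (w x))
    (heven : ∀ x, ‖x‖ = 1 → w (-x) = w x) :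
    ∀ x, ‖x‖ = 1 → w x = 0 := by
  intro x hx
  have hsol : MeanField.IsSol fun y => w (‖y‖⁻¹ • y) := by
    refine MeanField.isSol_of_sphere
      (fun y hy => (hsmooth y hy).contDiffAt (isOpen_ne.mem_nhds hy)) (fun p hp => ?_) heven
    rw [← hPDE p hp, InnerProductSpace.laplacian_eq_iteratedFDeriv_orthonormalBasis _
      (EuclideanSpace.basisFun (Fin 3) ℝ)]
    simp [sphereLaplacian]
  simpa [hx] using hsol.eq_zero (MeanField.ne_zero_of_norm_eq_one hx)
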